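/- arXiv:2004.10384 — 7 statements merged into one kernel-verified Lean document; each statement's English description precedes it below -/
import Mathlib

section
/- Let α ∈ (1,2), C_α > 0, a ≥ 0 and b, κ, λ ∈ ℝ. Let h : ℝ → ℝ be twice continuously differentiable with h ≥ 0, h(x) = |x| for all |x| ≥ 2, and with h' and h'' bounded, and set W(y,x) := 1 + y + h(x). Then there exists a constant C₀ > 0 such that for all y ≥ 0 and x ∈ ℝ: a − b·y + (κ − λ·x)·h'(x) + y·∫_0^∞ (h(x+z) − h(x) − h'(x)·z) ν_α(dz) ≤ C₀·W(y,x). -/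
open Set MeasureTheory

/-- The Lévy measure of a spectrally positive `α`-stable process:
`ν_α(dz) = C_α z^{-(1+α)} 1_{z>0} dz`. -/
noncomputable def nuMeasure (Cα α : ℝ) : Measure ℝ :=
  (volume.restrict (Ioi (0 : ℝ))).withDensity fun z => ENNReal.ofReal (Cα * z ^ (-(1 + α)))

/-- The compensated increment of a function with bounded first and second derivatives
is dominated by `min (M z²) (2 M z)`. -/
theorem abs_compensated_increment_le {h : ℝ → ℝ} (hh : ContDiff ℝ 2 h) {M : ℝ}
    (hM : ∀ x, |deriv h x| ≤ M ∧ |deriv (deriv h) x| ≤ M) (x : ℝ) {z : ℝ} (hz : 0 < z) :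
    |h (x + z) - h x - deriv h x * z| ≤ M * min z 2 * z := by
  have hM0 : 0 ≤ M := (abs_nonneg _).trans (hM 0).1
  have hd : Differentiable ℝ h := hh.differentiable (by norm_num)
  have hd' : Differentiable ℝ (deriv h) :=
    (hh.iterate_deriv' 1 1).differentiable (by norm_num)
  have hLip (w : ℝ) : |deriv h w - deriv h x| ≤ M * |w - x| :=
    convex_univ.norm_image_sub_le_of_norm_deriv_le (fun y _ => hd' y)
      (fun y _ => (hM y).2) (mem_univ x) (mem_univ w)
  have hder (w : ℝ) : HasDerivAt (fun w => h w - deriv h x * w) (deriv h w - deriv h x) w := by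
    exact (hd w).hasDerivAt.sub (by simpa using (hasDerivAt_id w).const_mul (deriv h x))
  have key := (convex_Icc x (x + z)).norm_image_sub_le_of_norm_hasDerivWithin_le
    (C := M * min z 2) (fun w _ => (hder w).hasDerivWithinAt)
    (fun w hw => by
      rw [Real.norm_eq_abs, mul_min_of_nonneg _ _ hM0]
      refine le_min ((hLip w).trans ?_) ?_
      · gcongr
        rw [abs_le]
        constructor <;> linarith [hw.1, hw.2]
      · linarith [abs_sub (deriv h w) (deriv h x), (hM w).1, (hM x).1])
    (left_mem_Icc.2 (by linarith)) (right_mem_Icc.2 (by linarith) : x + z ∈ Icc x (x + z))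
  have e : h (x + z) - deriv h x * (x + z) - (h x - deriv h x * x)
      = h (x + z) - h x - deriv h x * z := by ring
  simpa [e, abs_of_pos hz] using key

/-- `z ↦ min z 2 * z` is integrable against the Lévy measure for `α ∈ (1, 2)`. -/
theorem integrable_min_mul_nuMeasure {α Cα : ℝ} (hα : α ∈ Ioo (1 : ℝ) 2) (hCα : 0 < Cα) :
    Integrable (fun z => min z 2 * z) (nuMeasure Cα α) := by
  have hmeas : Measurable fun z : ℝ => ENNReal.ofReal (Cα * z ^ (-(1 + α))) := by fun_prop
  rw [nuMeasure, integrable_withDensity_iff_integrable_smul' hmeas (by simp)]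
  have hsmall : IntegrableOn (fun z : ℝ => Cα * z ^ (1 - α)) (Ioc 0 2) := by
    have := (intervalIntegral.intervalIntegrable_rpow' (a := 0) (b := 2) (r := 1 - α)
      (by linarith [hα.2])).const_mul Cα
    rwa [intervalIntegrable_iff_integrableOn_Ioc_of_le (by norm_num)] at this
  have hlarge : IntegrableOn (fun z : ℝ => 2 * Cα * z ^ (-α)) (Ioi 2) :=
    (integrableOn_Ioi_rpow_of_lt (by linarith [hα.1]) (by norm_num)).const_mul _
  have hdens {z : ℝ} (hz : 0 < z) :
      (ENNReal.ofReal (Cα * z ^ (-(1 + α)))).toReal = Cα * z ^ (-(1 + α)) :=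
    ENNReal.toReal_ofReal (by positivity)
  rw [← IntegrableOn, ← Ioc_union_Ioi_eq_Ioi (zero_le_two (α := ℝ))]
  refine IntegrableOn.union (hsmall.congr_fun (fun z hz => ?_) measurableSet_Ioc)
    (hlarge.congr_fun (fun z hz => ?_) measurableSet_Ioi)
  · have e : z ^ (1 - α) = z ^ (-(1 + α)) * z ^ (2 : ℝ) := by
      rw [← Real.rpow_add hz.1]; ring_nf
    simp only [smul_eq_mul, hdens hz.1, min_eq_left hz.2, e, Real.rpow_two]
    ring
  · have hz0 : (0 : ℝ) < z := zero_lt_two.trans hz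
    have e : z ^ (-α) = z ^ (-(1 + α)) * z := by
      nth_rewrite 3 [← Real.rpow_one z]
      rw [← Real.rpow_add hz0]; ring_nf
    simp only [smul_eq_mul, hdens hz0, min_eq_right (le_of_lt (mem_Ioi.1 hz)), e]
    ring

/-- Lyapunov estimate `L W ≤ C₀ W` for `W(y,x) = 1 + y + h(x)`:
for `h ∈ C²(ℝ)` nonnegative with `h(x) = |x|` for `|x| ≥ 2` and `h'`, `h''`
bounded, there exists `C₀ > 0` such that for all `y ≥ 0` and `x ∈ ℝ`,
`a - b y + (κ - λ x) h'(x) + y ∫₀^∞ (h(x+z) - h(x) - h'(x) z) ν_α(dz) ≤ C₀ W(y,x)`. -/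
theorem stmt4 (α Cα a b κ lam : ℝ) (hα : α ∈ Ioo (1 : ℝ) 2) (hCα : 0 < Cα)
    (ha : 0 ≤ a)
    (h : ℝ → ℝ) (hh : ContDiff ℝ 2 h) (hpos : ∀ x, 0 ≤ h x)
    (habs : ∀ x : ℝ, 2 ≤ |x| → h x = |x|)
    (hbd : ∃ M : ℝ, ∀ x : ℝ, |deriv h x| ≤ M ∧ |deriv (deriv h) x| ≤ M) :
    ∃ C₀ : ℝ, 0 < C₀ ∧ ∀ y x : ℝ, 0 ≤ y →
      a - b * y + (κ - lam * x) * deriv h x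
          + y * ∫ z, (h (x + z) - h x - deriv h x * z) ∂(nuMeasure Cα α)
        ≤ C₀ * (1 + y + h x) := by
  obtain ⟨M, hM⟩ := hbd
  have hM0 : 0 ≤ M := (abs_nonneg _).trans (hM 0).1
  set K : ℝ := ∫ z, M * (min z 2 * z) ∂(nuMeasure Cα α)
  have hpos_ae : ∀ᵐ z ∂(nuMeasure Cα α), 0 < z :=
    (withDensity_absolutelyContinuous _ _).ae_le (ae_restrict_mem measurableSet_Ioi)
  have hK0 : 0 ≤ K := integral_nonneg_of_ae <| by
    filter_upwards [hpos_ae] with z hz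
    simp only [Pi.zero_apply]
    positivity
  have hK (x : ℝ) : ∫ z, (h (x + z) - h x - deriv h x * z) ∂(nuMeasure Cα α) ≤ K := by
    refine (Real.le_norm_self _).trans (norm_integral_le_of_norm_le
      ((integrable_min_mul_nuMeasure hα hCα).const_mul M) ?_)
    filter_upwards [hpos_ae] with z hz
    simpa only [mul_assoc, Real.norm_eq_abs] using abs_compensated_increment_le hh hM x hz
  refine ⟨a + |b| + |κ| * M + 2 * (|lam| * M) + K + 1, by positivity, fun y x hy => ?_⟩
  have hx : |x| ≤ 2 + h x := by
    rcases le_total 2 |x| with hx | hx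
    · linarith [habs x hx]
    · linarith [hpos x]
  have hdrift : (κ - lam * x) * deriv h x ≤ |κ| * M + |lam| * M * (2 + h x) := by
    calc (κ - lam * x) * deriv h x ≤ |κ - lam * x| * |deriv h x| := by
          rw [← abs_mul]; exact le_abs_self _
      _ ≤ (|κ| + |lam| * (2 + h x)) * M := by
          gcongr
          · have := hpos x
            positivity
          · exact (abs_sub κ (lam * x)).trans (by rw [abs_mul]; gcongr)
          · exact (hM x).1
      _ = _ := by ring
  have hjump := mul_le_mul_of_nonneg_left (hK x) hy
  have hby : -b * y ≤ |b| * y := by gcongr; exact neg_le_abs b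
  have hW := hpos x
  have hlin : a - b * y + (κ - lam * x) * deriv h x
      + y * ∫ z, (h (x + z) - h x - deriv h x * z) ∂(nuMeasure Cα α)
      ≤ a + |b| * y + (|κ| * M + |lam| * M * (2 + h x)) + y * K := by linarith
  refine hlin.trans (sub_nonneg.1 ?_)
  have e : (a + |b| + |κ| * M + 2 * (|lam| * M) + K + 1) * (1 + y + h x)
      - (a + |b| * y + (|κ| * M + |lam| * M * (2 + h x)) + y * K)
      = (a + |κ| * M + 2 * (|lam| * M) + 1) * y + (a + |b| + |κ| * M + |lam| * M + K + 1) * h x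
        + |b| + K + 1 := by ring
  rw [e]
  positivity
end

section
/- (Proposition 3.1) Let b > 0, λ > 0, α ∈ (1,2) and C_α > 0, let g be the cutoff function and F, V_{c,θ} as defined. Then for every θ ∈ (0,1) there exist constants c > 0 and ζ > 0 such that for all y > ỹ ≥ 0 and all x, x̃ ∈ ℝ: (L*V_{c,θ})(y,ỹ,x,x̃) ≤ −ζ·V_{c,θ}(y − ỹ, |x − x̃|). -/
open Set MeasureTheory

/-- The cutoff function `g` from the paper. -/
def IsCutoff (δ : ℝ) (g : ℝ → ℝ) : Prop :=
  ContDiffOn ℝ 2 g (Ici 0) ∧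
  (∃ M : ℝ, ∀ r ∈ Ici (0 : ℝ), |g r| ≤ M ∧ |deriv g r| ≤ M ∧ |deriv (deriv g) r| ≤ M) ∧
  MonotoneOn g (Ici 0) ∧
  (∀ r ∈ Ici (0 : ℝ), g r ∈ Icc (0 : ℝ) 1) ∧
  (∀ r : ℝ, 0 ≤ r → r ≤ 1 → g r = 0) ∧
  (∀ r : ℝ, 1 < r → r < 3 / 2 → g r = (r - 1) ^ (2 + δ)) ∧
  (∀ r : ℝ, 2 ≤ r → g r = 1)

/-- `F(s,t) = (1 - g(t/s))·s + g(t/s)·t` for `s ≠ 0`, and `F(0,t) = t`. -/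
noncomputable def Fcut (g : ℝ → ℝ) (s t : ℝ) : ℝ :=
  if s = 0 then t else (1 - g (t / s)) * s + g (t / s) * t

/-- `V_{c,θ}(s,t) = c(s + s^θ) + F(s,t)`. -/
noncomputable def Vct (g : ℝ → ℝ) (c θ s t : ℝ) : ℝ :=
  c * (s + s ^ θ) + Fcut g s t

/-- first partial derivative in the first argument -/
noncomputable def D1 (G : ℝ → ℝ → ℝ) (s t : ℝ) : ℝ := deriv (fun a => G a t) s

/-- first partial derivative in the second argument -/
noncomputable def D2 (G : ℝ → ℝ → ℝ) (s t : ℝ) : ℝ := deriv (fun a => G s a) t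

/-- second partial derivative in the first argument -/
noncomputable def D11 (G : ℝ → ℝ → ℝ) (s t : ℝ) : ℝ := deriv (fun a => D1 G a t) s

/-- `σ = (x - x̃)/|x - x̃|` for `x ≠ x̃`, and `σ = 1` for `x = x̃`. -/
noncomputable def sgn' (x xt : ℝ) : ℝ := if x = xt then 1 else (x - xt) / |x - xt|

/-- The coupling operator `L*` (reflection coupling for `u < 1`, synchronous
coupling for `u ≥ 1` in the first component; synchronous coupling in the
second component), acting on `G(u,v)` with `u = y - ỹ`, `v = |x - x̃|`. -/
noncomputable def Lstar (b lam Cα α : ℝ) (G : ℝ → ℝ → ℝ) (y yt x xt : ℝ) : ℝ :=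
  -b * (y - yt) * D1 G (y - yt) |x - xt|
    + (1 / 2) * (Real.sqrt y + Real.sqrt yt) ^ 2 * D11 G (y - yt) |x - xt|
        * (if 0 < y - yt ∧ y - yt < 1 then 1 else 0)
    + (1 / 2) * (Real.sqrt y - Real.sqrt yt) ^ 2 * D11 G (y - yt) |x - xt|
        * (if 1 ≤ y - yt then 1 else 0)
    - lam * |x - xt| * D2 G (y - yt) |x - xt|
    + (y - yt) * ∫ z, (G (y - yt) |x - xt + z| - G (y - yt) |x - xt|
        - D2 G (y - yt) |x - xt| * sgn' x xt * z) ∂(nuMeasure Cα α)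

open Filter Topology

/-- `Φ` is a smooth nondecreasing interpolation between `1` on `(-∞, 1]` and the identity on
`[2, ∞)`, with first and second derivatives `A` and `B` bounded by `M`. -/
structure IsProfile (Φ A B : ℝ → ℝ) (M : ℝ) : Prop where
  hasDerivAt : ∀ r, HasDerivAt Φ (A r) r
  hasDerivAt_deriv : ∀ r, HasDerivAt A (B r) r
  eq_one : ∀ r ≤ 1, Φ r = 1
  eq_self : ∀ r, 2 ≤ r → Φ r = r
  monotone : Monotone Φ
  deriv_le : ∀ r, A r ≤ M
  abs_deriv2_le : ∀ r, |B r| ≤ M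

namespace IsProfile

variable {Φ A B : ℝ → ℝ} {M : ℝ}

lemma one_le (h : IsProfile Φ A B M) (r : ℝ) : 1 ≤ Φ r := by
  rw [← h.eq_one (min r 1) (min_le_right _ _)]
  exact h.monotone (min_le_left _ _)

lemma le_two (h : IsProfile Φ A B M) {r : ℝ} (hr : r ≤ 2) : Φ r ≤ 2 :=
  (h.monotone hr).trans (h.eq_self 2 le_rfl).le

lemma deriv_nonneg (h : IsProfile Φ A B M) (r : ℝ) : 0 ≤ A r :=
  (h.hasDerivAt r).nonneg_of_monotone h.monotone

lemma bound_nonneg (h : IsProfile Φ A B M) : 0 ≤ M :=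
  (abs_nonneg _).trans (h.abs_deriv2_le 0)

lemma deriv_eq_zero (h : IsProfile Φ A B M) {r : ℝ} (hr : r ≤ 1) : A r = 0 :=
  (uniqueDiffOn_Iic (1 : ℝ) r hr).eq_deriv _ (h.hasDerivAt r).hasDerivWithinAt
    ((hasDerivWithinAt_const r _ (1 : ℝ)).congr (fun x hx => h.eq_one x hx) (h.eq_one r hr))

lemma deriv_eq_one (h : IsProfile Φ A B M) {r : ℝ} (hr : 2 ≤ r) : A r = 1 :=
  (uniqueDiffOn_Ici (2 : ℝ) r hr).eq_deriv _ (h.hasDerivAt r).hasDerivWithinAt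
    ((hasDerivWithinAt_id r _).congr (fun x hx => h.eq_self x hx) (h.eq_self r hr))

lemma deriv2_eq_zero (h : IsProfile Φ A B M) {r : ℝ} (hr : 2 ≤ r) : B r = 0 :=
  (uniqueDiffOn_Ici (2 : ℝ) r hr).eq_deriv _ (h.hasDerivAt_deriv r).hasDerivWithinAt
    ((hasDerivWithinAt_const r _ (1 : ℝ)).congr (fun _ hx => h.deriv_eq_one hx)
      (h.deriv_eq_one hr))

lemma sub_mul_deriv_ge (h : IsProfile Φ A B M) {r : ℝ} :
    -(2 * M) ≤ Φ r - r * A r := by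
  have hM := h.bound_nonneg
  rcases le_total 2 r with hr | hr
  · rw [h.eq_self r hr, h.deriv_eq_one hr]; linarith
  · have := h.one_le r
    have := h.deriv_le r
    have := mul_le_mul_of_nonneg_right hr (h.deriv_nonneg r)
    linarith

lemma sq_mul_deriv2_le (h : IsProfile Φ A B M) {r : ℝ} (h0 : 0 ≤ r) : r ^ 2 * B r ≤ 4 * M := by
  have hM := h.bound_nonneg
  rcases le_total 2 r with hr | hr
  · rw [h.deriv2_eq_zero hr]; linarith
  · have h1 : r ^ 2 ≤ 4 := by nlinarith
    calc r ^ 2 * B r ≤ r ^ 2 * M :=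
          mul_le_mul_of_nonneg_left ((le_abs_self _).trans (h.abs_deriv2_le r)) (sq_nonneg r)
      _ ≤ 4 * M := mul_le_mul_of_nonneg_right h1 hM

lemma apply_abs (h : IsProfile Φ A B M) (r : ℝ) : Φ |r| = Φ r + Φ (-r) - 1 := by
  rcases le_total 0 r with hr | hr
  · rw [abs_of_nonneg hr, h.eq_one (-r) (by linarith)]; ring
  · rw [abs_of_nonpos hr, h.eq_one r (by linarith)]; ring

/-- The profile dissipates: either it is the identity, or it is at most `2`. -/
lemma neg_mul_deriv_le (h : IsProfile Φ A B M) {r : ℝ} (h0 : 0 ≤ r) :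
    -(r * A r) ≤ 2 - Φ r := by
  rcases le_total 2 r with hr | hr
  · rw [h.eq_self r hr, h.deriv_eq_one hr]; linarith
  · have := h.le_two hr
    have := mul_nonneg h0 (h.deriv_nonneg r)
    linarith

/-- First-order Taylor remainder of `r ↦ Φ |r|`. -/
lemma abs_remainder_le (h : IsProfile Φ A B M) (p : ℝ) {q : ℝ} (hq : 0 < q) :
    |Φ |p + q| - Φ |p| - (A p - A (-p)) * q| ≤ 2 * M * min (q ^ 2) (2 * q) := by
  have hM := h.bound_nonneg
  have hd : ∀ r, HasDerivAt (fun r => Φ r + Φ (-r)) (A r - A (-r)) r := fun r =>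
    ((h.hasDerivAt r).add ((h.hasDerivAt (-r)).comp r (hasDerivAt_neg r))).congr_deriv (by ring)
  have hA : ∀ r s, |A r - A s| ≤ M * |r - s| := fun r s => by
    simpa [Real.norm_eq_abs] using convex_univ.norm_image_sub_le_of_norm_hasDerivWithin_le
      (fun x _ => (h.hasDerivAt_deriv x).hasDerivWithinAt)
      (fun x _ => h.abs_deriv2_le x) (mem_univ s) (mem_univ r)
  obtain ⟨ξ, ⟨h1, h2⟩, hξ⟩ := exists_hasDerivAt_eq_slope _ _ (show p < p + q by linarith)
    (fun x _ => (hd x).continuousAt.continuousWithinAt) (fun x _ => hd x)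
  have e : Φ |p + q| - Φ |p| - (A p - A (-p)) * q
      = ((A ξ - A (-ξ)) - (A p - A (-p))) * q := by
    rw [h.apply_abs, h.apply_abs, hξ, add_sub_cancel_left]
    field_simp
    ring
  have hA0 := h.deriv_nonneg
  have hA1 := h.deriv_le
  rw [e, abs_mul, abs_of_pos hq, mul_min_of_nonneg _ _ (by linarith)]
  apply le_min
  · have b1 := abs_le.1 (hA ξ p)
    have b2 := abs_le.1 (hA (-ξ) (-p))
    rw [abs_of_nonneg (by linarith : 0 ≤ ξ - p)] at b1
    rw [abs_of_nonpos (by linarith : -ξ - -p ≤ 0)] at b2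
    have b3 : M * (ξ - p) ≤ M * q := mul_le_mul_of_nonneg_left (by linarith) hM
    have b4 : |A ξ - A (-ξ) - (A p - A (-p))| ≤ 2 * M * q := by
      rw [abs_le]; constructor <;> nlinarith
    calc _ ≤ 2 * M * q * q := mul_le_mul_of_nonneg_right b4 hq.le
      _ = _ := by ring
  · have b4 : |A ξ - A (-ξ) - (A p - A (-p))| ≤ 4 * M := by
      have := hA0 ξ; have := hA0 (-ξ); have := hA0 p; have := hA0 (-p)
      have := hA1 ξ; have := hA1 (-ξ); have := hA1 p; have := hA1 (-p)
      rw [abs_le]; constructor <;> linarith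
    calc _ ≤ 4 * M * q := mul_le_mul_of_nonneg_right b4 hq.le
      _ = _ := by ring

end IsProfile

/-- `F` is the perspective of a smooth profile. -/
lemma IsCutoff.exists_profile {δ : ℝ} {g : ℝ → ℝ} (hg : IsCutoff δ g) :
    ∃ Φ A B : ℝ → ℝ, ∃ M : ℝ, IsProfile Φ A B M ∧
      ∀ s t : ℝ, 0 < s → 0 ≤ t → Fcut g s t = s * Φ (t / s) := by
  obtain ⟨hC, -, hmono, h01, hz, -, ho⟩ := hg
  set G : ℝ → ℝ := fun r => if r ≤ 1 then 0 else g r with hG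
  have hGg : ∀ r, 0 ≤ r → G r = g r := fun r hr => by
    by_cases h : r ≤ 1
    · simp [hG, h, hz r hr h]
    · simp [hG, h]
  have hG0 : ∀ r ≤ 1, G r = 0 := fun r hr => by simp [hG, hr]
  have hGC : ContDiff ℝ 2 G := by
    rw [contDiff_iff_contDiffAt]
    intro r
    by_cases h : r < 1
    · exact contDiffAt_const.congr_of_eventuallyEq
        (by filter_upwards [Iio_mem_nhds h] with x hx using hG0 x (le_of_lt hx))
    · have hr : 0 < r := by linarith
      exact (hC.contDiffAt (Ici_mem_nhds hr)).congr_of_eventuallyEq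
        (by filter_upwards [Ioi_mem_nhds hr] with x hx using hGg x (le_of_lt hx))
  have hΦC : ContDiff ℝ 2 (fun r => 1 + G r * (r - 1)) := by fun_prop
  set Φ : ℝ → ℝ := fun r => 1 + G r * (r - 1) with hΦ
  obtain ⟨hd, -, hC1⟩ := (contDiff_succ_iff_deriv (n := 1)).1 hΦC
  obtain ⟨hd1, -, hC2⟩ := (contDiff_succ_iff_deriv (n := 0)).1 hC1
  have hcA : Continuous (deriv Φ) := hC1.continuous
  have hcB : Continuous (deriv (deriv Φ)) := hC2.continuous
  have hΦ1 : ∀ r ≤ 1, Φ r = 1 := fun r hr => by simp [hΦ, hG0 r hr]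
  have hΦ2 : ∀ r, 2 ≤ r → Φ r = r := fun r hr => by
    simp [hΦ, hGg r (by linarith), ho r hr]
  have hA1 : ∀ r < 1, deriv Φ r = 0 := fun r hr => by
    have : Φ =ᶠ[𝓝 r] fun _ => 1 := by
      filter_upwards [Iio_mem_nhds hr] with x hx using hΦ1 x (le_of_lt hx)
    simp [this.deriv_eq]
  have hA2 : ∀ r, 2 < r → deriv Φ r = 1 := fun r hr => by
    have : Φ =ᶠ[𝓝 r] fun x => x := by
      filter_upwards [Ioi_mem_nhds hr] with x hx using hΦ2 x (le_of_lt hx)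
    simp [this.deriv_eq]
  have hB1 : ∀ r < 1, deriv (deriv Φ) r = 0 := fun r hr => by
    have : deriv Φ =ᶠ[𝓝 r] fun _ => 0 := by
      filter_upwards [Iio_mem_nhds hr] with x hx using hA1 x hx
    simp [this.deriv_eq]
  have hB2 : ∀ r, 2 < r → deriv (deriv Φ) r = 0 := fun r hr => by
    have : deriv Φ =ᶠ[𝓝 r] fun _ => 1 := by
      filter_upwards [Ioi_mem_nhds hr] with x hx using hA2 x hx
    simp [this.deriv_eq]
  obtain ⟨M₁, hM₁⟩ := (isCompact_Icc (a := (1 : ℝ)) (b := 2)).exists_bound_of_continuousOn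
    hcA.continuousOn
  obtain ⟨M₂, hM₂⟩ := (isCompact_Icc (a := (1 : ℝ)) (b := 2)).exists_bound_of_continuousOn
    hcB.continuousOn
  have hM₁0 : 0 ≤ M₁ := (norm_nonneg _).trans (hM₁ 1 ⟨le_rfl, by norm_num⟩)
  have hM₂0 : 0 ≤ M₂ := (norm_nonneg _).trans (hM₂ 1 ⟨le_rfl, by norm_num⟩)
  refine ⟨Φ, deriv Φ, deriv (deriv Φ), M₁ + M₂ + 1, ⟨fun r => (hd r).hasDerivAt,
    fun r => (hd1 r).hasDerivAt, hΦ1, hΦ2, ?_, ?_, ?_⟩, ?_⟩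
  · intro r s hrs
    rcases le_total r 1 with h | h
    · rw [hΦ1 r h]
      rcases le_total s 1 with h' | h'
      · rw [hΦ1 s h']
      · have := (h01 s (show (0 : ℝ) ≤ s by linarith)).1
        simp only [hΦ, hGg s (by linarith)]
        nlinarith
    · have h1 := hmono (show (0 : ℝ) ≤ r by linarith) (show (0 : ℝ) ≤ s by linarith) hrs
      have h2 := (h01 r (show (0 : ℝ) ≤ r by linarith)).1
      simp only [hΦ, hGg r (by linarith), hGg s (by linarith)]
      have := mul_le_mul h1 (show r - 1 ≤ s - 1 by linarith) (by linarith) (h2.trans h1)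
      linarith
  · intro r
    rcases lt_or_ge r 1 with h | h
    · rw [hA1 r h]; linarith
    · rcases lt_or_ge 2 r with h' | h'
      · rw [hA2 r h']; linarith
      · have := (le_abs_self _).trans (hM₁ r ⟨h, h'⟩); linarith
  · intro r
    rcases lt_or_ge r 1 with h | h
    · rw [hB1 r h, abs_zero]; linarith
    · rcases lt_or_ge 2 r with h' | h'
      · rw [hB2 r h', abs_zero]; linarith
      · have := hM₂ r ⟨h, h'⟩; rw [Real.norm_eq_abs] at this; linarith
  · intro s t hs ht
    simp only [Fcut, hs.ne', if_false, hΦ, hGg (t / s) (by positivity)]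
    field_simp
    ring

lemma integral_nuMeasure {Cα α : ℝ} (hC : 0 < Cα) (f : ℝ → ℝ) :
    ∫ z, f z ∂(nuMeasure Cα α) = ∫ z in Ioi (0 : ℝ), Cα * z ^ (-(1 + α)) * f z := by
  rw [nuMeasure, integral_withDensity_eq_integral_toReal_smul (by fun_prop)
    (by filter_upwards with z using ENNReal.ofReal_lt_top)]
  refine setIntegral_congr_fun measurableSet_Ioi fun z hz => ?_
  have : 0 ≤ Cα * z ^ (-(1 + α)) := mul_nonneg hC.le (Real.rpow_nonneg (le_of_lt hz) _)
  simp only [ENNReal.toReal_ofReal this, smul_eq_mul]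

/-- A Taylor remainder at scale `u` has a `ν_α`-integral of order `u ^ (-α)`. -/
lemma abs_integral_nuMeasure_le {Cα α : ℝ} (hα : α ∈ Ioo (1 : ℝ) 2) (hC : 0 < Cα)
    {u K : ℝ} (hu : 0 < u) (hK : 0 ≤ K) (f : ℝ → ℝ)
    (hf : ∀ z, 0 < z → |f z| ≤ K * min ((z / u) ^ 2) (2 * (z / u))) :
    |∫ z, f z ∂(nuMeasure Cα α)|
      ≤ K * (Cα * (1 / (2 - α) + 2 / (α - 1)) * u ^ (-α)) := by
  obtain ⟨h1, h2⟩ := hα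
  set P : ℝ → ℝ := fun z => K * Cα / u ^ 2 * z ^ (1 - α) with hP
  set Q : ℝ → ℝ := fun z => 2 * K * Cα / u * z ^ (-α) with hQ
  have iP : IntegrableOn P (Ioc 0 u) := by
    have := (intervalIntegral.intervalIntegrable_rpow' (a := 0) (b := u)
      (show -1 < 1 - α by linarith)).1
    exact this.const_mul _
  have iQ : IntegrableOn Q (Ioi u) :=
    (integrableOn_Ioi_rpow_of_lt (show -α < -1 by linarith) hu).const_mul _
  have vP : ∫ z in Ioc 0 u, P z = K * Cα / u ^ 2 * (u ^ (2 - α) / (2 - α)) := by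
    rw [← intervalIntegral.integral_of_le hu.le, intervalIntegral.integral_const_mul,
      integral_rpow (Or.inl (by linarith)), show 1 - α + 1 = 2 - α by ring,
      Real.zero_rpow (by linarith), sub_zero]
  have vQ : ∫ z in Ioi u, Q z = 2 * K * Cα / u * (u ^ (1 - α) / (α - 1)) := by
    rw [integral_const_mul, integral_Ioi_rpow_of_lt (by linarith) hu,
      show -α + 1 = 1 - α by ring, ← neg_sub α 1, neg_div_neg_eq]
  set H : ℝ → ℝ := fun z => if z ≤ u then P z else Q z with hH
  have eP : EqOn H P (Ioc 0 u) := fun z hz => by simp [hH, hz.2]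
  have eQ : EqOn H Q (Ioi u) := fun z hz => by simp [hH, not_le.2 (mem_Ioi.1 hz)]
  have jP := (integrableOn_congr_fun eP measurableSet_Ioc (μ := volume)).2 iP
  have jQ := (integrableOn_congr_fun eQ measurableSet_Ioi (μ := volume)).2 iQ
  have hU : Ioc 0 u ∪ Ioi u = Ioi (0 : ℝ) := Ioc_union_Ioi_eq_Ioi hu.le
  have jH : IntegrableOn H (Ioi 0) := hU ▸ jP.union jQ
  have vH : ∫ z in Ioi 0, H z = (∫ z in Ioc 0 u, P z) + ∫ z in Ioi u, Q z := by
    rw [← hU, setIntegral_union (Ioc_disjoint_Ioi le_rfl) measurableSet_Ioi jP jQ,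
      setIntegral_congr_fun measurableSet_Ioc eP, setIntegral_congr_fun measurableSet_Ioi eQ]
  rw [integral_nuMeasure hC, ← Real.norm_eq_abs]
  refine (norm_integral_le_of_norm_le jH ?_).trans_eq ?_
  · refine (ae_restrict_iff' measurableSet_Ioi).2 (Eventually.of_forall fun z (hz : 0 < z) => ?_)
    have hz' : 0 ≤ Cα * z ^ (-(1 + α)) := mul_nonneg hC.le (Real.rpow_nonneg hz.le _)
    rw [Real.norm_eq_abs, abs_mul, abs_of_nonneg hz']
    refine (mul_le_mul_of_nonneg_left (hf z hz) hz').trans ?_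
    by_cases h : z ≤ u
    · simp only [hH, h, if_true, hP]
      rw [show (1 : ℝ) - α = -(1 + α) + (2 : ℕ) by push_cast; ring,
        Real.rpow_add_natCast hz.ne']
      refine (mul_le_mul_of_nonneg_left
        (mul_le_mul_of_nonneg_left (min_le_left _ _) hK) hz').trans_eq ?_
      field_simp
    · simp only [hH, h, if_false, hQ]
      rw [show -α = -(1 + α) + (1 : ℕ) by push_cast; ring,
        Real.rpow_add_natCast hz.ne']
      refine (mul_le_mul_of_nonneg_left
        (mul_le_mul_of_nonneg_left (min_le_right _ _) hK) hz').trans_eq ?_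
      field_simp
  · rw [vH, vP, vQ, show 2 - α = -α + (2 : ℕ) by push_cast; ring,
      show 1 - α = -α + (1 : ℕ) by push_cast; ring, Real.rpow_add_natCast hu.ne',
      Real.rpow_add_natCast hu.ne']
    have : -α + ((2 : ℕ) : ℝ) ≠ 0 := by push_cast; linarith
    have : α - 1 ≠ 0 := by linarith
    field_simp

lemma hasDerivAt_const_div (t : ℝ) {s : ℝ} (hs : s ≠ 0) :
    HasDerivAt (fun a : ℝ => t / a) (-t / s ^ 2) s :=
  ((hasDerivAt_const s t).div (hasDerivAt_id s) hs).congr_deriv (by simp)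

section Vct

variable {Φ A B g : ℝ → ℝ} {M c θ : ℝ}

lemma Vct_eq_profile (hF : ∀ s t : ℝ, 0 < s → 0 ≤ t → Fcut g s t = s * Φ (t / s)) {s t : ℝ}
    (hs : 0 < s) (ht : 0 ≤ t) : Vct g c θ s t = c * (s + s ^ θ) + s * Φ (t / s) := by
  rw [Vct, hF s t hs ht]

lemma D1_Vct (h : IsProfile Φ A B M)
    (hF : ∀ s t : ℝ, 0 < s → 0 ≤ t → Fcut g s t = s * Φ (t / s)) {s t : ℝ}
    (hs : 0 < s) (ht : 0 ≤ t) :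
    D1 (Vct g c θ) s t = c * (1 + θ * s ^ (θ - 1)) + (Φ (t / s) - t / s * A (t / s)) := by
  have e : (fun a => Vct g c θ a t) =ᶠ[𝓝 s] fun a => c * (a + a ^ θ) + a * Φ (t / a) := by
    filter_upwards [Ioi_mem_nhds hs] with a ha using Vct_eq_profile hF ha ht
  have hq := hasDerivAt_const_div t hs.ne'
  rw [D1, e.deriv_eq]
  refine (HasDerivAt.congr_deriv ((((hasDerivAt_id s).add
    (Real.hasDerivAt_rpow_const (p := θ) (Or.inl hs.ne'))).const_mul c).add
    ((hasDerivAt_id s).mul ((h.hasDerivAt (t / s)).comp s hq))) ?_).deriv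
  simp only [id, Function.comp]
  field_simp
  ring

lemma D11_Vct (h : IsProfile Φ A B M)
    (hF : ∀ s t : ℝ, 0 < s → 0 ≤ t → Fcut g s t = s * Φ (t / s)) {s t : ℝ}
    (hs : 0 < s) (ht : 0 ≤ t) :
    D11 (Vct g c θ) s t
      = -(c * (θ * (1 - θ)) * s ^ (θ - 2)) + (t / s) ^ 2 * B (t / s) / s := by
  have e : (fun a => D1 (Vct g c θ) a t) =ᶠ[𝓝 s]
      fun a => c * (1 + θ * a ^ (θ - 1)) + (Φ (t / a) - t / a * A (t / a)) := by
    filter_upwards [Ioi_mem_nhds hs] with a ha using D1_Vct h hF ha ht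
  have hq := hasDerivAt_const_div t hs.ne'
  rw [D11, e.deriv_eq]
  refine (HasDerivAt.congr_deriv (((((Real.hasDerivAt_rpow_const (p := θ - 1)
    (Or.inl hs.ne')).const_mul θ).const_add 1).const_mul c).add
    (((h.hasDerivAt (t / s)).comp s hq).sub
      (hq.mul ((h.hasDerivAt_deriv (t / s)).comp s hq)))) ?_).deriv
  rw [show θ - 1 - 1 = θ - 2 by ring]
  simp only [Function.comp]
  field_simp
  ring

lemma D2_Vct (h : IsProfile Φ A B M)
    (hF : ∀ s t : ℝ, 0 < s → 0 ≤ t → Fcut g s t = s * Φ (t / s)) {s t : ℝ}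
    (hs : 0 < s) (ht : 0 ≤ t) : D2 (Vct g c θ) s t = A (t / s) := by
  have hd : HasDerivAt (fun a => c * (s + s ^ θ) + s * Φ (a / s)) (A (t / s)) t := by
    refine HasDerivAt.congr_deriv (((h.hasDerivAt (t / s)).comp t
      ((hasDerivAt_id t).div_const s)).const_mul s |>.const_add (c * (s + s ^ θ))) ?_
    field_simp
  rcases ht.eq_or_lt with rfl | ht'
  · by_cases hdiff : DifferentiableAt ℝ (fun a => Vct g c θ s a) 0
    · exact (uniqueDiffOn_Ici (0 : ℝ) 0 self_mem_Ici).eq_deriv _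
        hdiff.hasDerivAt.hasDerivWithinAt
        (hd.hasDerivWithinAt.congr (fun a ha => Vct_eq_profile hF hs ha)
          (Vct_eq_profile hF hs le_rfl))
    · rw [D2, deriv_zero_of_not_differentiableAt hdiff, h.deriv_eq_zero (by simp)]
  · have e : (fun a => Vct g c θ s a) =ᶠ[𝓝 t] fun a => c * (s + s ^ θ) + s * Φ (a / s) := by
      filter_upwards [Ioi_mem_nhds ht'] with a ha using Vct_eq_profile hF hs (le_of_lt ha)
    rw [D2, e.deriv_eq]
    exact hd.deriv

lemma D2_Vct_mul_sgn' (h : IsProfile Φ A B M)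
    (hF : ∀ s t : ℝ, 0 < s → 0 ≤ t → Fcut g s t = s * Φ (t / s)) {s : ℝ}
    (hs : 0 < s) (x xt : ℝ) :
    D2 (Vct g c θ) s |x - xt| * sgn' x xt = A ((x - xt) / s) - A (-((x - xt) / s)) := by
  rw [D2_Vct h hF hs (abs_nonneg _), sgn']
  rcases lt_trichotomy x xt with hx | rfl | hx
  · have hneg : x - xt < 0 := by linarith
    rw [if_neg hx.ne, abs_of_neg hneg, div_neg, div_self hneg.ne, neg_div,
      h.deriv_eq_zero (r := (x - xt) / s) ((div_neg_of_neg_of_pos hneg hs).le.trans zero_le_one)]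
    ring
  · simp [h.deriv_eq_zero]
  · have hpos : 0 < x - xt := by linarith
    rw [if_neg hx.ne', abs_of_pos hpos, div_self hpos.ne',
      h.deriv_eq_zero (r := -((x - xt) / s))
        ((neg_neg_of_pos (div_pos hpos hs)).le.trans zero_le_one)]
    ring

/-- The jump part of the coupling operator is of order `u ^ (2 - α)`. -/
lemma jump_part_le {Cα α : ℝ} (hα : α ∈ Ioo (1 : ℝ) 2) (hC : 0 < Cα) (h : IsProfile Φ A B M)
    (hF : ∀ s t : ℝ, 0 < s → 0 ≤ t → Fcut g s t = s * Φ (t / s)) {u : ℝ}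
    (hu : 0 < u) (x xt : ℝ) :
    u * ∫ z, (Vct g c θ u |x - xt + z| - Vct g c θ u |x - xt|
        - D2 (Vct g c θ) u |x - xt| * sgn' x xt * z) ∂(nuMeasure Cα α)
      ≤ 2 * M * (Cα * (1 / (2 - α) + 2 / (α - 1))) * u ^ (2 - α) := by
  have hM := h.bound_nonneg
  have key := abs_integral_nuMeasure_le hα hC hu (K := u * (2 * M)) (by positivity)
    (fun z => Vct g c θ u |x - xt + z| - Vct g c θ u |x - xt|
        - D2 (Vct g c θ) u |x - xt| * sgn' x xt * z) fun z hz => by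
    rw [D2_Vct_mul_sgn' h hF hu, Vct_eq_profile hF hu (abs_nonneg _),
      Vct_eq_profile hF hu (abs_nonneg _)]
    have := mul_le_mul_of_nonneg_left (h.abs_remainder_le ((x - xt) / u) (div_pos hz hu)) hu.le
    rw [← add_div, abs_div, abs_div, abs_of_pos hu] at this
    rw [mul_assoc u]
    refine le_trans (le_of_eq ?_) this
    conv_rhs => rw [← abs_of_pos hu, ← abs_mul, abs_of_pos hu]
    congr 1
    field_simp
    ring
  refine (mul_le_mul_of_nonneg_left ((le_abs_self _).trans key) hu.le).trans_eq ?_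
  rw [show 2 - α = -α + (2 : ℕ) by push_cast; ring, Real.rpow_add_natCast hu.ne']
  push_cast
  rw [show -α + 2 = 2 - α by ring]
  ring

end Vct

lemma sub_le_sq_sqrt_add_sqrt {y yt : ℝ} (h0 : 0 ≤ yt) (hy : yt < y) :
    y - yt ≤ (Real.sqrt y + Real.sqrt yt) ^ 2 := by
  nlinarith [Real.sq_sqrt h0, Real.sq_sqrt (h0.trans hy.le), Real.sqrt_nonneg y,
    Real.sqrt_nonneg yt, mul_nonneg (Real.sqrt_nonneg y) (Real.sqrt_nonneg yt)]

lemma sq_sqrt_sub_sqrt_le_sub {y yt : ℝ} (h0 : 0 ≤ yt) (hy : yt < y) :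
    (Real.sqrt y - Real.sqrt yt) ^ 2 ≤ y - yt := by
  nlinarith [Real.sq_sqrt h0, Real.sq_sqrt (h0.trans hy.le), Real.sqrt_nonneg y,
    Real.sqrt_nonneg yt, mul_nonneg (Real.sqrt_nonneg yt)
      (sub_nonneg.2 (Real.sqrt_le_sqrt hy.le))]

/-- The diffusion part compensates a jump part of size at most `J * u ^ (2 - α)`, up to a term
linear in `u`. -/
lemma diffusion_add_jump_le {α θ k M J D y yt : ℝ} (hα : α ∈ Ioo (1 : ℝ) 2)
    (hθ : θ ∈ Ioo (0 : ℝ) 1) (hM : 0 ≤ M) (hJ : 0 ≤ J) (hk : 4 * M + 2 * J ≤ k)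
    (h0 : 0 ≤ yt) (hy : yt < y)
    (hD : D ≤ -(k * (y - yt) ^ (θ - 2)) + 4 * M / (y - yt)) :
    (1 / 2) * (Real.sqrt y + Real.sqrt yt) ^ 2 * D
        * (if 0 < y - yt ∧ y - yt < 1 then 1 else 0)
      + (1 / 2) * (Real.sqrt y - Real.sqrt yt) ^ 2 * D * (if 1 ≤ y - yt then 1 else 0)
      + J * (y - yt) ^ (2 - α) ≤ (2 * M + J) * (y - yt) := by
  have hP := sub_le_sq_sqrt_add_sqrt h0 hy
  have hQ := sq_sqrt_sub_sqrt_le_sub h0 hy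
  have hQ0 := sq_nonneg (Real.sqrt y - Real.sqrt yt)
  have hu : 0 < y - yt := sub_pos.2 hy
  set P := (Real.sqrt y + Real.sqrt yt) ^ 2
  set Q := (Real.sqrt y - Real.sqrt yt) ^ 2
  set u := y - yt
  obtain ⟨hα1, hα2⟩ := hα
  obtain ⟨hθ0, hθ1⟩ := hθ
  have hk0 : 0 ≤ k := by linarith
  rcases lt_or_ge u 1 with h1 | h1
  · rw [if_pos ⟨hu, h1⟩, if_neg (not_le.2 h1)]
    have e1 : u ^ (2 - α) ≤ 1 := Real.rpow_le_one hu.le h1.le (by linarith)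
    have e2 : 1 / u ≤ u ^ (θ - 2) := by
      rw [one_div, ← Real.rpow_neg_one]
      exact Real.rpow_le_rpow_of_exponent_ge hu h1.le (by linarith)
    have e3 : D ≤ -(2 * J / u) := by
      have := mul_le_mul_of_nonneg_left e2 hk0
      have h4 : (4 * M + 2 * J) * (1 / u) ≤ k * (1 / u) :=
        mul_le_mul_of_nonneg_right hk (by positivity)
      have h5 : (4 * M + 2 * J) * (1 / u) = 4 * M / u + 2 * J / u := by ring
      linarith
    have e4 : P * D ≤ -(2 * J) :=
      calc P * D ≤ P * -(2 * J / u) := mul_le_mul_of_nonneg_left e3 (hu.le.trans hP)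
        _ ≤ u * -(2 * J / u) :=
          mul_le_mul_of_nonpos_right hP (neg_nonpos.2 (by positivity))
        _ = -(2 * J) := by field_simp
    have := mul_le_mul_of_nonneg_left e1 hJ
    have : 0 ≤ (2 * M + J) * u := by positivity
    linarith
  · rw [if_neg (fun h => absurd h.2 (not_lt.2 h1)), if_pos h1]
    have e1 : u ^ (2 - α) ≤ u := by
      simpa using Real.rpow_le_rpow_of_exponent_le h1 (show 2 - α ≤ 1 by linarith)
    have e3 : D ≤ 4 * M / u := by
      have : 0 ≤ k * u ^ (θ - 2) := mul_nonneg hk0 (Real.rpow_nonneg hu.le _)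
      linarith
    have e4 : Q * D ≤ 4 * M :=
      calc Q * D ≤ Q * (4 * M / u) := mul_le_mul_of_nonneg_left e3 hQ0
        _ ≤ u * (4 * M / u) := mul_le_mul_of_nonneg_right hQ (by positivity)
        _ = 4 * M := by field_simp
    have := mul_le_mul_of_nonneg_left e1 hJ
    have : M * 1 ≤ M * u := mul_le_mul_of_nonneg_left h1 hM
    linarith

/-- Proposition 3.1: for every `θ ∈ (0,1)` there exist `c, ζ > 0` such that
for all `y > ỹ ≥ 0` and `x, x̃ ∈ ℝ`,
`(L* V_{c,θ})(y,ỹ,x,x̃) ≤ -ζ V_{c,θ}(y - ỹ, |x - x̃|)`. -/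
theorem stmt5 (b lam α Cα δ : ℝ) (hb : 0 < b) (hlam : 0 < lam)
    (hα : α ∈ Ioo (1 : ℝ) 2) (hCα : 0 < Cα) (hδ : 0 < δ)
    (g : ℝ → ℝ) (hg : IsCutoff δ g) :
    ∀ θ ∈ Ioo (0 : ℝ) 1, ∃ c ζ : ℝ, 0 < c ∧ 0 < ζ ∧
      ∀ y yt x xt : ℝ, 0 ≤ yt → yt < y →
        Lstar b lam Cα α (Vct g c θ) y yt x xt
          ≤ -ζ * Vct g c θ (y - yt) |x - xt| := by
  intro θ hθ
  obtain ⟨Φ, A, B, M, h, hF⟩ := hg.exists_profile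
  have hM := h.bound_nonneg
  have hθ0 : 0 < θ := hθ.1
  have hθ1 : 0 < 1 - θ := sub_pos.2 hθ.2
  set J : ℝ := 2 * M * (Cα * (1 / (2 - α) + 2 / (α - 1))) with hJdef
  have hJ : 0 ≤ J := by
    have := sub_pos.2 hα.1
    have := sub_pos.2 hα.2
    positivity
  set c : ℝ := (4 * M + 2 * J) / (θ * (1 - θ)) + 2 * (2 * M * b + 2 * lam + 2 * M + J) / b
    with hc
  have hc0 : 0 < c := by positivity
  have hc1 : 4 * M + 2 * J ≤ c * (θ * (1 - θ)) := by
    rw [← div_le_iff₀ (by positivity), hc]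
    exact le_add_of_nonneg_right (by positivity)
  have hc2 : 2 * (2 * M * b + 2 * lam + 2 * M + J) ≤ c * b := by
    rw [← div_le_iff₀ hb, hc]
    exact le_add_of_nonneg_left (by positivity)
  set ζ : ℝ := min (b / 2) (min (b * θ) lam) with hζ
  have hζ1 : ζ ≤ b / 2 := min_le_left _ _
  have hζ2 : ζ ≤ b * θ := (min_le_right _ _).trans (min_le_left _ _)
  have hζ3 : ζ ≤ lam := (min_le_right _ _).trans (min_le_right _ _)
  refine ⟨c, ζ, hc0, by positivity, fun y yt x xt h0 hy => ?_⟩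
  have hu : 0 < y - yt := sub_pos.2 hy
  have hv := abs_nonneg (x - xt)
  have hjump := jump_part_le (c := c) (θ := θ) hα hCα h hF hu x xt
  have hr : 0 ≤ |x - xt| / (y - yt) := by positivity
  have hD : D11 (Vct g c θ) (y - yt) |x - xt|
      ≤ -(c * (θ * (1 - θ)) * (y - yt) ^ (θ - 2)) + 4 * M / (y - yt) := by
    rw [D11_Vct h hF hu hv]
    exact add_le_add_right (div_le_div_of_nonneg_right (h.sq_mul_deriv2_le hr) hu.le) _
  have hdiff := diffusion_add_jump_le hα hθ hM hJ hc1 h0 hy hD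
  have hdrift : -b * (y - yt) * D1 (Vct g c θ) (y - yt) |x - xt|
      ≤ -(b * c) * ((y - yt) + θ * (y - yt) ^ θ) + 2 * M * b * (y - yt) := by
    have e : (y - yt) * (y - yt) ^ (θ - 1) = (y - yt) ^ θ := by
      rw [Real.rpow_sub_one hu.ne']; field_simp
    have := mul_le_mul_of_nonneg_left (h.sub_mul_deriv_ge (r := |x - xt| / (y - yt)))
      (mul_pos hb hu).le
    rw [D1_Vct h hF hu hv, ← e]
    linarith
  have hsecond : -(lam * |x - xt| * D2 (Vct g c θ) (y - yt) |x - xt|)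
      ≤ lam * (y - yt) * (2 - Φ (|x - xt| / (y - yt))) := by
    rw [D2_Vct h hF hu hv]
    refine le_trans (le_of_eq ?_)
      (mul_le_mul_of_nonneg_left (h.neg_mul_deriv_le hr) (mul_pos hlam hu).le)
    field_simp
  rw [← hJdef] at hjump
  rw [Lstar]
  conv_rhs => rw [Vct_eq_profile hF hu hv]
  set u := y - yt
  set φ := Φ (|x - xt| / u)
  have hφ : 0 ≤ u * φ := mul_nonneg hu.le (zero_le_one.trans (h.one_le _))
  have hw : 0 ≤ c * u ^ θ := mul_nonneg hc0.le (Real.rpow_nonneg hu.le _)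
  have k1 := mul_le_mul_of_nonneg_right hζ1 (mul_pos hc0 hu).le
  have k2 := mul_le_mul_of_nonneg_right hζ2 hw
  have k3 := mul_le_mul_of_nonneg_right hζ3 hφ
  have k4 := mul_le_mul_of_nonneg_right hc2 hu.le
  linarith
end

section
/- Let α ∈ (1,2) and C_α > 0. Then there exists a constant c₂ > 0 such that for all u > 0 and all x, x̃ ∈ ℝ with |x − x̃| ≥ 2u: ∫_{{z > 0 : |x + z − x̃| > 2u}} (|x + z − x̃| − |x − x̃| − σ·z) ν_α(dz) ≤ c₂·u^{1−α}. -/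
open Set MeasureTheory

theorem excess_bounds {u x xt z : ℝ} (hu : 0 < u) (h : 2 * u ≤ |x - xt|) (hz : 0 < z) :
    0 ≤ |x + z - xt| - |x - xt| - sgn' x xt * z ∧
      |x + z - xt| - |x - xt| - sgn' x xt * z ≤ (Ioi (2 * u)).indicator (fun z => 2 * z) z := by
  have hne : x ≠ xt := by
    rintro rfl
    simp at h
    linarith
  have hind : 0 ≤ (Ioi (2 * u)).indicator (fun z : ℝ => 2 * z) z := by
    by_cases hz' : z ∈ Ioi (2 * u)
    · rw [indicator_of_mem hz']
      positivity
    · rw [indicator_of_notMem hz']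
  rcases lt_or_gt_of_ne hne with hlt | hgt
  · have hs : sgn' x xt = -1 := by
      rw [sgn', if_neg hne, abs_of_neg (sub_neg.2 hlt), div_neg,
        div_self (sub_neg.2 hlt).ne]
    rw [abs_of_neg (sub_neg.2 hlt)] at h
    rw [hs, abs_of_neg (sub_neg.2 hlt)]
    rcases le_total (x + z - xt) 0 with h0 | h0
    · rw [abs_of_nonpos h0]
      constructor <;> linarith
    · rw [abs_of_nonneg h0]
      refine ⟨by linarith, ?_⟩
      rcases eq_or_lt_of_le h0 with h1 | h1
      · linarith
      · rw [indicator_of_mem (show z ∈ Ioi (2 * u) by rw [mem_Ioi]; linarith)]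
        linarith
  · have hs : sgn' x xt = 1 := by
      rw [sgn', if_neg hne, abs_of_pos (sub_pos.2 hgt), div_self (sub_pos.2 hgt).ne']
    rw [hs, abs_of_pos (sub_pos.2 hgt), abs_of_pos (by linarith)]
    constructor <;> linarith

theorem measurable_nuMeasure_density (Cα α : ℝ) :
    Measurable fun z : ℝ => ENNReal.ofReal (Cα * z ^ (-(1 + α))) := by
  fun_prop

theorem ae_pos_nuMeasure (Cα α : ℝ) : ∀ᵐ z ∂(nuMeasure Cα α), 0 < z :=
  (withDensity_absolutelyContinuous _ _).ae_le (ae_restrict_mem measurableSet_Ioi)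

theorem indicator_mul_density {Cα α t z : ℝ} (hCα : 0 ≤ Cα) (hz : 0 < z) :
    (Ioi t).indicator (fun z => 2 * z) z * (ENNReal.ofReal (Cα * z ^ (-(1 + α)))).toReal =
      (Ioi t).indicator (fun z => 2 * Cα * z ^ (-α)) z := by
  rw [ENNReal.toReal_ofReal (by positivity)]
  by_cases hzt : z ∈ Ioi t
  · rw [indicator_of_mem hzt, indicator_of_mem hzt]
    have : z ^ (-α) = z * z ^ (-(1 + α)) := by
      rw [show -α = 1 + -(1 + α) by ring, Real.rpow_add hz, Real.rpow_one]
    rw [this]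
    ring
  · simp [indicator_of_notMem hzt]

theorem integrable_tail_nuMeasure {Cα α t : ℝ} (hCα : 0 ≤ Cα) (hα : 1 < α) (ht : 0 < t) :
    Integrable ((Ioi t).indicator fun z : ℝ => 2 * z) (nuMeasure Cα α) := by
  rw [nuMeasure, integrable_withDensity_iff (measurable_nuMeasure_density Cα α)
    (Filter.Eventually.of_forall fun _ => ENNReal.ofReal_lt_top)]
  have h : Integrable ((Ioi t).indicator fun z : ℝ => 2 * Cα * z ^ (-α))
      (volume.restrict (Ioi 0)) :=
    ((integrable_indicator_iff measurableSet_Ioi).2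
      ((integrableOn_Ioi_rpow_of_lt (a := -α) (by linarith) ht).const_mul (2 * Cα))).restrict
  refine h.congr ?_
  filter_upwards [ae_restrict_mem measurableSet_Ioi] with z hz
  exact (indicator_mul_density hCα hz).symm

theorem integral_tail_nuMeasure {Cα α t : ℝ} (hCα : 0 ≤ Cα) (hα : 1 < α) (ht : 0 < t) :
    ∫ z, (Ioi t).indicator (fun z : ℝ => 2 * z) z ∂(nuMeasure Cα α) =
      2 * Cα / (α - 1) * t ^ (1 - α) := by
  rw [nuMeasure, integral_withDensity_eq_integral_toReal_smul (measurable_nuMeasure_density Cα α)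
    (Filter.Eventually.of_forall fun _ => ENNReal.ofReal_lt_top)]
  have h : ∀ z ∈ Ioi (0 : ℝ), (ENNReal.ofReal (Cα * z ^ (-(1 + α)))).toReal •
      (Ioi t).indicator (fun z : ℝ => 2 * z) z =
        (Ioi t).indicator (fun z => 2 * Cα * z ^ (-α)) z := fun z hz => by
    rw [smul_eq_mul, mul_comm, indicator_mul_density hCα hz]
  rw [setIntegral_congr_fun measurableSet_Ioi h, setIntegral_indicator measurableSet_Ioi,
    inter_eq_self_of_subset_right (Ioi_subset_Ioi ht.le), integral_const_mul,
    integral_Ioi_rpow_of_lt (by linarith) ht, show -α + 1 = 1 - α by ring,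
    ← neg_sub α 1, div_neg]
  ring

/-- Estimate \eqref{W2} on `I₂`: there is `c₂ > 0` such that for all `u > 0`
and `x, x̃` with `|x - x̃| ≥ 2u`,
`∫_{|x+z-x̃| > 2u} (|x+z-x̃| - |x-x̃| - σ z) ν_α(dz) ≤ c₂ u^{1-α}`. -/
theorem stmt8 (α Cα : ℝ) (hα : α ∈ Ioo (1 : ℝ) 2) (hCα : 0 < Cα) :
    ∃ c₂ : ℝ, 0 < c₂ ∧ ∀ u x xt : ℝ, 0 < u → 2 * u ≤ |x - xt| →
      (∫ z in {z : ℝ | 2 * u < |x + z - xt|},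
          (|x + z - xt| - |x - xt| - sgn' x xt * z) ∂(nuMeasure Cα α))
        ≤ c₂ * u ^ (1 - α) := by
  have hα1 : 0 < α - 1 := sub_pos.2 hα.1
  refine ⟨2 * Cα / (α - 1) * 2 ^ (1 - α), by positivity, fun u x xt hu hx => ?_⟩
  have h2u : 0 < 2 * u := by positivity
  have hg := integrable_tail_nuMeasure hCα.le hα.1 h2u
  have hpos := ae_pos_nuMeasure Cα α
  calc _ ≤ ∫ z in {z : ℝ | 2 * u < |x + z - xt|},
          (Ioi (2 * u)).indicator (fun z : ℝ => 2 * z) z ∂(nuMeasure Cα α) := by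
        refine integral_mono_of_nonneg (ae_restrict_of_ae ?_) hg.restrict (ae_restrict_of_ae ?_)
        · filter_upwards [hpos] with z hz using (excess_bounds hu hx hz).1
        · filter_upwards [hpos] with z hz using (excess_bounds hu hx hz).2
    _ ≤ ∫ z, (Ioi (2 * u)).indicator (fun z : ℝ => 2 * z) z ∂(nuMeasure Cα α) := by
        refine setIntegral_le_integral hg ?_
        filter_upwards [hpos] with z hz
        exact (excess_bounds hu hx hz).1.trans (excess_bounds hu hx hz).2
    _ = _ := by
        rw [integral_tail_nuMeasure hCα.le hα.1 h2u, Real.mul_rpow zero_le_two hu.le, mul_assoc]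
end

section
/- Let α ∈ (1,2) and C_α > 0, and let g and F be as defined. Then there exists a constant c > 0 such that for all u > 0 and all x, x̃ ∈ ℝ with u ≤ |x − x̃| ≤ 2u: ∫_{{0 < z ≤ u/2}} ( F(u, |x − x̃ + z|) − F(u, |x − x̃|) − ∂_2F(u, |x − x̃|)·σ·z ) ν_α(dz) ≤ c·u^{1−α}. -/
open Set MeasureTheory

/-- The second-order remainder of `f` at `a` is at most `K (b - a)²` if `|f''| ≤ K` on a convex
set containing `a` and `b`. -/
theorem abs_taylor_remainder_le {f f' f'' : ℝ → ℝ} {s : Set ℝ} {K a b : ℝ} (hs : Convex ℝ s)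
    (hf : ∀ r ∈ s, HasDerivAt f (f' r) r) (hf' : ∀ r ∈ s, HasDerivAt f' (f'' r) r)
    (hK : ∀ r ∈ s, |f'' r| ≤ K) (ha : a ∈ s) (hb : b ∈ s) :
    |f b - f a - f' a * (b - a)| ≤ K * (b - a) ^ 2 := by
  have hK0 : 0 ≤ K := (abs_nonneg _).trans (hK a ha)
  have hsub : uIcc a b ⊆ s := by
    rw [← segment_eq_uIcc]
    exact hs.segment_subset ha hb
  have hbound : ∀ r ∈ uIcc a b, ‖f' r - f' a‖ ≤ K * |b - a| := by
    intro r hr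
    have h := hs.norm_image_sub_le_of_norm_hasDerivWithin_le
      (fun y hy => (hf' y hy).hasDerivWithinAt) hK ha (hsub hr)
    refine h.trans (mul_le_mul_of_nonneg_left ?_ hK0)
    simpa [Real.norm_eq_abs, abs_sub_comm] using abs_sub_left_of_mem_uIcc hr
  have h := (convex_uIcc a b).norm_image_sub_le_of_norm_hasDerivWithin_le
    (f := fun y => f y - f' a * y)
    (fun y hy => ((hf y (hsub hy)).sub
      (by simpa using (hasDerivAt_id y).const_mul (f' a))).hasDerivWithinAt)
    hbound left_mem_uIcc right_mem_uIcc
  calc |f b - f a - f' a * (b - a)| = ‖f b - f' a * b - (f a - f' a * a)‖ := by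
        rw [Real.norm_eq_abs]; congr 1; ring
    _ ≤ K * |b - a| * ‖b - a‖ := h
    _ = K * (b - a) ^ 2 := by rw [Real.norm_eq_abs, mul_assoc, abs_mul_abs_self]; ring

theorem nuMeasure_restrict_Ioc (Cα α b : ℝ) :
    (nuMeasure Cα α).restrict (Ioc 0 b) =
      (volume.restrict (Ioc 0 b)).withDensity fun z => ENNReal.ofReal (Cα * z ^ (-(1 + α))) := by
  rw [nuMeasure, restrict_withDensity measurableSet_Ioc, Measure.restrict_restrict measurableSet_Ioc,
    inter_eq_left.2 Ioc_subset_Ioi_self]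

theorem sq_mul_density_eq {Cα α K z : ℝ} (hCα : 0 < Cα) (hz : 0 < z) :
    K * z ^ 2 * (ENNReal.ofReal (Cα * z ^ (-(1 + α)))).toReal = K * Cα * z ^ (1 - α) := by
  rw [ENNReal.toReal_ofReal (by positivity), show (1 - α) = 2 + -(1 + α) by ring,
    Real.rpow_add hz, Real.rpow_two]
  ring

theorem integrableOn_sq_nuMeasure {α Cα b : ℝ} (K : ℝ) (hα : α < 2) (hCα : 0 < Cα)
    (hb : 0 ≤ b) :
    IntegrableOn (fun z => K * z ^ 2) (Ioc 0 b) (nuMeasure Cα α) := by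
  rw [IntegrableOn, nuMeasure_restrict_Ioc,
    integrable_withDensity_iff (by fun_prop) (by simp)]
  have h : IntegrableOn (fun z : ℝ => K * Cα * z ^ (1 - α)) (Ioc 0 b) :=
    (((intervalIntegrable_iff_integrableOn_Ioc_of_le hb).1
      (intervalIntegral.intervalIntegrable_rpow' (by linarith))).const_mul _)
  exact h.congr_fun (fun z hz => (sq_mul_density_eq hCα hz.1).symm) measurableSet_Ioc

theorem setIntegral_sq_nuMeasure {α Cα b : ℝ} (K : ℝ) (hα : α < 2) (hCα : 0 < Cα)
    (hb : 0 ≤ b) :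
    ∫ z in Ioc 0 b, K * z ^ 2 ∂(nuMeasure Cα α) = K * Cα * (b ^ (2 - α) / (2 - α)) := by
  rw [nuMeasure_restrict_Ioc,
    integral_withDensity_eq_integral_toReal_smul (by fun_prop) (by simp)]
  calc _ = ∫ z in Ioc 0 b, K * Cα * z ^ (1 - α) := by
        refine setIntegral_congr_fun measurableSet_Ioc fun z hz => ?_
        simp only [smul_eq_mul]
        rw [← sq_mul_density_eq hCα hz.1, mul_comm]
    _ = K * Cα * (b ^ (2 - α) / (2 - α)) := by
        rw [integral_const_mul, ← intervalIntegral.integral_of_le hb,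
          integral_rpow (Or.inl (by linarith)), show 1 - α + 1 = 2 - α by ring,
          Real.zero_rpow (by linarith), sub_zero]

/-- `F(s, t) = s · p(t / s)` with the profile `p(r) = 1 + g(r)(r - 1)`. -/
theorem Fcut_eq_mul_profile (g : ℝ → ℝ) {u : ℝ} (hu : u ≠ 0) (t : ℝ) :
    Fcut g u t = u * (1 + g (t / u) * (t / u - 1)) := by
  rw [Fcut, if_neg hu]
  field_simp
  ring

theorem D2_Fcut {g : ℝ → ℝ} {u t : ℝ} (hu : u ≠ 0) {d : ℝ}
    (h : HasDerivAt (fun r => 1 + g r * (r - 1)) d (t / u)) : D2 (Fcut g) u t = d := by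
  have h1 : HasDerivAt (fun a => u * (1 + g (a / u) * (a / u - 1))) (u * (d * (1 / u))) t :=
    (HasDerivAt.comp t (h₂ := fun r => 1 + g r * (r - 1)) (h := fun a => a / u) h
      ((hasDerivAt_id t).div_const u)).const_mul u
  rw [D2, funext (Fcut_eq_mul_profile g hu), h1.deriv]
  field_simp

theorem abs_add_eq_abs_add_sgn'_mul {x xt z : ℝ} (hne : x ≠ xt) (hz : |z| ≤ |x - xt|) :
    |x - xt + z| = |x - xt| + sgn' x xt * z := by
  rw [sgn', if_neg hne]
  rcases lt_or_gt_of_ne (sub_ne_zero.2 hne) with h | h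
  · rw [abs_of_neg h] at hz ⊢
    rw [div_neg, div_self h.ne, abs_of_nonpos (by linarith [le_abs_self z])]
    ring
  · rw [abs_of_pos h] at hz ⊢
    rw [div_self h.ne', abs_of_nonneg (by linarith [neg_abs_le z])]
    ring

theorem sgn'_sq {x xt : ℝ} : sgn' x xt ^ 2 = 1 := by
  rw [sgn']
  split_ifs with h
  · simp
  · rw [div_pow, sq_abs, div_self (pow_ne_zero 2 (sub_ne_zero.2 h))]

theorem abs_Fcut_remainder_le {δ : ℝ} {g : ℝ → ℝ} (hg : IsCutoff δ g) :
    ∃ K : ℝ, 0 < K ∧ ∀ u x xt z : ℝ, 0 < u → u ≤ |x - xt| → |x - xt| ≤ 2 * u →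
      0 < z → z ≤ u / 2 →
      |Fcut g u |x - xt + z| - Fcut g u |x - xt| - D2 (Fcut g) u |x - xt| * sgn' x xt * z|
        ≤ K / u * z ^ 2 := by
  obtain ⟨hC, ⟨M, hM⟩, -⟩ := hg
  have hC' : ContDiffOn ℝ 2 g (Ioi 0) := hC.mono Ioi_subset_Ici_self
  have hg1 : ∀ r ∈ Ioi (0 : ℝ), HasDerivAt g (deriv g r) r := fun r hr =>
    ((hC'.differentiableOn (by norm_num)).differentiableAt (Ioi_mem_nhds hr)).hasDerivAt
  have hg2 : ∀ r ∈ Ioi (0 : ℝ), HasDerivAt (deriv g) (deriv (deriv g) r) r := fun r hr =>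
    (((contDiffOn_succ_iff_deriv_of_isOpen (n := 1) isOpen_Ioi).1 hC').2.2.differentiableOn
      (by norm_num) |>.differentiableAt (Ioi_mem_nhds hr)).hasDerivAt
  have hpos : Icc (1 / 2 : ℝ) (5 / 2) ⊆ Ioi 0 := fun r hr => by
    simp only [mem_Icc, mem_Ioi] at *; linarith
  have hM0 : 0 ≤ M := (abs_nonneg _).trans (hM 0 (by simp)).1
  have hp1 : ∀ r ∈ Icc (1 / 2 : ℝ) (5 / 2),
      HasDerivAt (fun r => 1 + g r * (r - 1)) (deriv g r * (r - 1) + g r) r := fun r hr => by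
    simpa using ((hg1 r (hpos hr)).mul ((hasDerivAt_id r).sub_const 1)).const_add 1
  have hp2 : ∀ r ∈ Icc (1 / 2 : ℝ) (5 / 2),
      HasDerivAt (fun r => deriv g r * (r - 1) + g r)
        (deriv (deriv g) r * (r - 1) + deriv g r + deriv g r) r := fun r hr => by
    have h := (hg2 r (hpos hr)).fun_mul ((hasDerivAt_id r).sub_const 1)
    simpa using h.fun_add (hg1 r (hpos hr))
  have hp3 : ∀ r ∈ Icc (1 / 2 : ℝ) (5 / 2),
      |deriv (deriv g) r * (r - 1) + deriv g r + deriv g r| ≤ 4 * M + 1 := fun r hr => by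
    obtain ⟨-, h1, h2⟩ := hM r (Ioi_subset_Ici_self (hpos hr))
    have h3 : |deriv (deriv g) r * (r - 1)| ≤ M * 2 := by
      rw [abs_mul]
      exact mul_le_mul h2 (abs_le.2 ⟨by linarith [hr.1], by linarith [hr.2]⟩) (abs_nonneg _) hM0
    rw [abs_le] at *
    constructor <;> linarith
  refine ⟨4 * M + 1, by linarith, fun u x xt z hu h1 h2 hz0 hz => ?_⟩
  have hne : x ≠ xt := fun h => by simp [h] at h1; linarith
  have hσ : |sgn' x xt * z| ≤ u / 2 := by
    rw [abs_mul, show |sgn' x xt| = 1 by rw [← sq_eq_sq₀ (abs_nonneg _) zero_le_one, sq_abs, sgn'_sq, one_pow], one_mul, abs_of_pos hz0]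
    exact hz
  have hσ' := abs_le.1 hσ
  have ha : |x - xt| / u ∈ Icc (1 / 2 : ℝ) (5 / 2) := by
    constructor
    · rw [le_div_iff₀ hu]; linarith
    · rw [div_le_iff₀ hu]; linarith
  have hb : (|x - xt| + sgn' x xt * z) / u ∈ Icc (1 / 2 : ℝ) (5 / 2) := by
    constructor
    · rw [le_div_iff₀ hu]; linarith
    · rw [div_le_iff₀ hu]; linarith
  have h := abs_taylor_remainder_le (convex_Icc _ _) hp1 hp2 hp3 ha hb
  rw [D2_Fcut hu.ne' (hp1 _ ha), abs_add_eq_abs_add_sgn'_mul hne (by rw [abs_of_pos hz0]; linarith),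
    Fcut_eq_mul_profile g hu.ne', Fcut_eq_mul_profile g hu.ne']
  rw [show (|x - xt| + sgn' x xt * z) / u - |x - xt| / u = sgn' x xt * z / u by ring] at h
  generalize (|x - xt| + sgn' x xt * z) / u = b at *
  generalize |x - xt| / u = a at *
  have h4 := mul_le_mul_of_nonneg_left h hu.le
  rw [← abs_of_pos hu, ← abs_mul, abs_of_pos hu] at h4
  calc _ = |u * (1 + g b * (b - 1) - (1 + g a * (a - 1)) -
        (deriv g a * (a - 1) + g a) * (sgn' x xt * z / u))| := by
        congr 1; field_simp
    _ ≤ _ := h4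
    _ = (4 * M + 1) / u * z ^ 2 := by
        rw [div_pow, mul_pow, sgn'_sq]; field_simp

/-- Estimate on `Λ₁`: there is `c > 0` such that for all `u > 0` and `x, x̃`
with `u ≤ |x - x̃| ≤ 2u`,
`∫_{0 < z ≤ u/2} (F(u,|x-x̃+z|) - F(u,|x-x̃|) - ∂₂F(u,|x-x̃|) σ z) ν_α(dz) ≤ c u^{1-α}`. -/
theorem stmt12 (α Cα δ : ℝ) (hα : α ∈ Ioo (1 : ℝ) 2) (hCα : 0 < Cα) (hδ : 0 < δ)
    (g : ℝ → ℝ) (hg : IsCutoff δ g) :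
    ∃ c : ℝ, 0 < c ∧ ∀ u x xt : ℝ, 0 < u → u ≤ |x - xt| → |x - xt| ≤ 2 * u →
      (∫ z in Ioc (0 : ℝ) (u / 2),
          (Fcut g u |x - xt + z| - Fcut g u |x - xt|
            - D2 (Fcut g) u |x - xt| * sgn' x xt * z) ∂(nuMeasure Cα α))
        ≤ c * u ^ (1 - α) := by
  obtain ⟨K, hK, hbound⟩ := abs_Fcut_remainder_le hg
  have hα2 : 0 < 2 - α := by linarith [hα.2]
  refine ⟨K * Cα / (2 - α), by positivity, fun u x xt hu h1 h2 => ?_⟩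
  refine (Real.le_norm_self _).trans ((norm_integral_le_of_norm_le
    (integrableOn_sq_nuMeasure (K / u) hα.2 hCα (half_pos hu).le)
    (ae_restrict_of_forall_mem measurableSet_Ioc fun z hz =>
      hbound u x xt z hu h1 h2 hz.1 hz.2)).trans ?_)
  rw [setIntegral_sq_nuMeasure _ hα.2 hCα (half_pos hu).le]
  have h3 : (u / 2) ^ (2 - α) ≤ u ^ (1 - α) * u := by
    rw [← Real.rpow_add_one hu.ne', show 1 - α + 1 = 2 - α by ring]
    exact Real.rpow_le_rpow (half_pos hu).le (by linarith) hα2.le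
  calc K / u * Cα * ((u / 2) ^ (2 - α) / (2 - α))
      ≤ K / u * Cα * (u ^ (1 - α) * u / (2 - α)) := by gcongr
    _ = K * Cα / (2 - α) * u ^ (1 - α) := by field_simp
end

section
/- Let α ∈ (1,2) and C_α > 0, and let g and F be as defined. Then there exists a constant c > 0 such that for all u > 0 and all x, x̃ ∈ ℝ with u ≤ |x − x̃| ≤ 2u: ∫_{{z ≥ u/2}} ( F(u, |x − x̃ + z|) − F(u, |x − x̃|) − ∂_2F(u, |x − x̃|)·σ·z ) ν_α(dz) ≤ c·u^{1−α}. -/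
open Set MeasureTheory

/-- Restricting `ν_α` to `[a, ∞)` for `a > 0` removes the cutoff at the origin. -/
lemma nuMeasure_restrict_Ici (Cα α : ℝ) {a : ℝ} (ha : 0 < a) :
    (nuMeasure Cα α).restrict (Ici a) =
      (volume.restrict (Ioi a)).withDensity fun z => ENNReal.ofReal (Cα * z ^ (-(1 + α))) := by
  rw [nuMeasure, restrict_withDensity measurableSet_Ici, Measure.restrict_restrict measurableSet_Ici,
    inter_eq_left.2 (Ici_subset_Ioi.2 ha),
    ← restrict_Ioi_eq_restrict_Ici]

lemma toReal_density_mul_eq {Cα α a z : ℝ} (hCα : 0 ≤ Cα) (ha : 0 < a) (hz : z ∈ Ioi a) :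
    (ENNReal.ofReal (Cα * z ^ (-(1 + α)))).toReal * z = Cα * z ^ (-α) := by
  have hz0 : 0 < z := ha.trans hz
  rw [ENNReal.toReal_ofReal (by positivity), mul_assoc, ← Real.rpow_add_one hz0.ne']
  ring_nf

/-- The tail of `ν_α` away from the origin has a finite first moment. -/
lemma integrableOn_id_nuMeasure {Cα α a : ℝ} (hCα : 0 ≤ Cα) (hα : 1 < α) (ha : 0 < a) :
    IntegrableOn (fun z => z) (Ici a) (nuMeasure Cα α) := by
  rw [IntegrableOn, nuMeasure_restrict_Ici Cα α ha,
    integrable_withDensity_iff_integrable_smul' (by fun_prop) (by simp)]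
  have h := (integrableOn_Ioi_rpow_of_lt (by linarith : -α < -1) ha).const_mul Cα
  exact IntegrableOn.congr_fun h (fun z hz => (toReal_density_mul_eq hCα ha hz).symm) measurableSet_Ioi

lemma setIntegral_id_nuMeasure {Cα α a : ℝ} (hCα : 0 ≤ Cα) (hα : 1 < α) (ha : 0 < a) :
    ∫ z in Ici a, z ∂(nuMeasure Cα α) = Cα * (a ^ (1 - α) / (α - 1)) := by
  rw [nuMeasure_restrict_Ici Cα α ha,
    integral_withDensity_eq_integral_toReal_smul (by fun_prop) (by simp)]
  simp only [smul_eq_mul]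
  rw [setIntegral_congr_fun measurableSet_Ioi fun z hz => toReal_density_mul_eq hCα ha hz,
    integral_const_mul, integral_Ioi_rpow_of_lt (by linarith) ha,
    neg_div, ← div_neg]
  ring_nf

lemma abs_sgn'_le_one (x xt : ℝ) : |sgn' x xt| ≤ 1 := by
  unfold sgn'
  split_ifs with h
  · simp
  · rw [abs_div, abs_abs]
    exact div_self_le_one _

lemma Fcut_nonneg {g : ℝ → ℝ} (hg : ∀ r ∈ Ici (0 : ℝ), g r ∈ Icc (0 : ℝ) 1) {s t : ℝ}
    (hs : 0 < s) (ht : 0 ≤ t) : 0 ≤ Fcut g s t := by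
  obtain ⟨h0, h1⟩ := hg (t / s) (div_nonneg ht hs.le)
  rw [Fcut, if_neg hs.ne']
  have := mul_nonneg (sub_nonneg.2 h1) hs.le
  positivity

lemma Fcut_le_add {g : ℝ → ℝ} (hg : ∀ r ∈ Ici (0 : ℝ), g r ∈ Icc (0 : ℝ) 1) {s t : ℝ}
    (hs : 0 < s) (ht : 0 ≤ t) : Fcut g s t ≤ s + t := by
  obtain ⟨h0, h1⟩ := hg (t / s) (div_nonneg ht hs.le)
  rw [Fcut, if_neg hs.ne']
  nlinarith [mul_nonneg h0 hs.le, mul_nonneg (sub_nonneg.2 h1) ht]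

lemma D2_Fcut_eq {g : ℝ → ℝ} {s t : ℝ} (hs : 0 < s) (hg : DifferentiableAt ℝ g (t / s)) :
    D2 (Fcut g) s t = deriv g (t / s) * ((t - s) / s) + g (t / s) := by
  have h1 : HasDerivAt (fun b => g (b / s)) (deriv g (t / s) * (1 / s)) t :=
    hg.hasDerivAt.comp t ((hasDerivAt_id t).div_const s)
  have h2 : HasDerivAt (fun b => Fcut g s b)
      (-(deriv g (t / s) * (1 / s)) * s + (deriv g (t / s) * (1 / s) * t + g (t / s) * 1)) t := by
    simp only [Fcut, if_neg hs.ne']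
    exact ((h1.const_sub 1).mul_const s).add (h1.mul (hasDerivAt_id t))
  rw [D2, h2.deriv]
  ring

lemma abs_D2_Fcut_le {g : ℝ → ℝ} {M s t : ℝ} (hg : ContDiffOn ℝ 2 g (Ici 0))
    (hM : ∀ r ∈ Ici (0 : ℝ), |deriv g r| ≤ M) (h01 : ∀ r ∈ Ici (0 : ℝ), g r ∈ Icc (0 : ℝ) 1)
    (hs : 0 < s) (hst : s ≤ t) (hts : t ≤ 2 * s) : |D2 (Fcut g) s t| ≤ M + 1 := by
  have hr : 0 < t / s := div_pos (hs.trans_le hst) hs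
  have hd : DifferentiableAt ℝ g (t / s) :=
    (hg.differentiableOn (by norm_num)).differentiableAt (Ici_mem_nhds hr)
  obtain ⟨h0, h1⟩ := h01 _ hr.le
  rw [D2_Fcut_eq hs hd]
  have hq : |(t - s) / s| ≤ 1 := by
    rw [abs_of_nonneg (div_nonneg (by linarith) hs.le), div_le_one hs]
    linarith
  have hm := hM _ hr.le
  calc _ ≤ |deriv g (t / s)| * |(t - s) / s| + |g (t / s)| := by
        rw [← abs_mul]; exact abs_add_le _ _
    _ ≤ M * 1 + 1 := by
        gcongr
        · exact (abs_nonneg _).trans hm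
        · rwa [abs_of_nonneg h0]
    _ = M + 1 := by ring

/-- Estimate on `Λ₂`: there is `c > 0` such that for all `u > 0` and `x, x̃`
with `u ≤ |x - x̃| ≤ 2u`,
`∫_{z ≥ u/2} (F(u,|x-x̃+z|) - F(u,|x-x̃|) - ∂₂F(u,|x-x̃|) σ z) ν_α(dz) ≤ c u^{1-α}`. -/
theorem stmt13 (α Cα δ : ℝ) (hα : α ∈ Ioo (1 : ℝ) 2) (hCα : 0 < Cα) (hδ : 0 < δ)
    (g : ℝ → ℝ) (hg : IsCutoff δ g) :
    ∃ c : ℝ, 0 < c ∧ ∀ u x xt : ℝ, 0 < u → u ≤ |x - xt| → |x - xt| ≤ 2 * u →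
      (∫ z in Ici (u / 2),
          (Fcut g u |x - xt + z| - Fcut g u |x - xt|
            - D2 (Fcut g) u |x - xt| * sgn' x xt * z) ∂(nuMeasure Cα α))
        ≤ c * u ^ (1 - α) := by
  obtain ⟨hα1, -⟩ := hα
  obtain ⟨hC2, ⟨M, hM⟩, -, h01, -⟩ := hg
  have hM0 : 0 ≤ M := (abs_nonneg _).trans (hM 0 self_mem_Ici).2.1
  have hα0 : 0 < α - 1 := by linarith
  refine ⟨(M + 8) * (Cα * ((1 / 2) ^ (1 - α) / (α - 1))), by positivity, ?_⟩
  intro u x xt hu hux hxu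
  have hu2 : 0 < u / 2 := by positivity
  by_cases hint : IntegrableOn (fun z => Fcut g u |x - xt + z| - Fcut g u |x - xt|
      - D2 (Fcut g) u |x - xt| * sgn' x xt * z) (Ici (u / 2)) (nuMeasure Cα α)
  · have hid := integrableOn_id_nuMeasure hCα.le hα1 hu2
    calc _ ≤ ∫ z in Ici (u / 2), (M + 8) * z ∂(nuMeasure Cα α) := by
          refine setIntegral_mono_on hint (hid.const_mul _) measurableSet_Ici fun z hz => ?_
          have hz' : u / 2 ≤ z := hz
          have hz0 : 0 < z := hu2.trans_le hz'
          have hF := Fcut_le_add h01 hu (abs_nonneg (x - xt + z))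
          have hF0 := Fcut_nonneg h01 hu (abs_nonneg (x - xt))
          have habs := abs_add_le (x - xt) z
          rw [abs_of_pos hz0] at habs
          have hD : |D2 (Fcut g) u |x - xt| * sgn' x xt| ≤ M + 1 := by
            rw [abs_mul]
            exact (mul_le_of_le_one_right (abs_nonneg _) (abs_sgn'_le_one x xt)).trans
              (abs_D2_Fcut_le hC2 (fun r hr => (hM r hr).2.1) h01 hu hux hxu)
          have hlin := mul_le_mul_of_nonneg_right (abs_le.1 hD).1 hz0.le
          linarith
      _ = _ := by
          rw [integral_const_mul, setIntegral_id_nuMeasure hCα.le hα1 hu2,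
            show u / 2 = 1 / 2 * u by ring, Real.mul_rpow (by norm_num) hu.le]
          ring
  · rw [integral_undef hint]
    positivity
end

section
/- (Proposition 4.1) Let b > 0, λ > 0, α, β ∈ (1,2), C_α > 0 and C_β > 0, let g be the cutoff function and F, V_{c,θ} as defined, and let L* be the synchronous coupling operator. Then for every θ ∈ (0, 2 − max(α,β)] there exist constants c > 0 and η > 0 such that for all y > ỹ ≥ 0 and all x, x̃ ∈ ℝ: (L*V_{c,θ})(y,ỹ,x,x̃) ≤ −η·V_{c,θ}(y − ỹ, |x − x̃|). -/
open Set MeasureTheory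

/-- The synchronous coupling operator `L*` for the two-factor process driven
by two spectrally positive stable noises, acting on `G(u,v)` with
`u = y - ỹ`, `v = |x - x̃|`. -/
noncomputable def LstarSync (b lam Cβ β Cα α : ℝ) (G : ℝ → ℝ → ℝ) (y yt x xt : ℝ) : ℝ :=
  -b * (y - yt) * D1 G (y - yt) |x - xt|
    - lam * |x - xt| * D2 G (y - yt) |x - xt|
    + (y - yt) * ∫ z, (G (y - yt + z) |x - xt| - G (y - yt) |x - xt|
        - D1 G (y - yt) |x - xt| * z) ∂(nuMeasure Cβ β)
    + (y - yt) * ∫ z, (G (y - yt) |x - xt + z| - G (y - yt) |x - xt|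
        - D2 G (y - yt) |x - xt| * sgn' x xt * z) ∂(nuMeasure Cα α)

/-- The integral of a function, integrable or not, is at most that of any nonnegative integrable
majorant. -/
lemma integral_le_of_le_of_nonneg {X : Type*} [MeasurableSpace X] {μ : Measure X} {f F : X → ℝ}
    (hF : Integrable F μ) (hF0 : 0 ≤ F) (h : f ≤ F) : ∫ x, f x ∂μ ≤ ∫ x, F x ∂μ := by
  by_cases hf : Integrable f μ
  · exact integral_mono hf hF h
  · rw [integral_undef hf]
    exact integral_nonneg hF0

lemma integral_nuMeasure_le {C α κ u : ℝ} (hC : 0 < C) (hα : α ∈ Ioo (1 : ℝ) 2) (hκ : 0 ≤ κ)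
    (hu : 0 < u) {φ : ℝ → ℝ} (hφ : ∀ z, 0 < z → φ z ≤ κ * min (z ^ 2 / u) z) :
    ∫ z, φ z ∂(nuMeasure C α) ≤ κ * C * (1 / (2 - α) + 1 / (α - 1)) * u ^ (1 - α) := by
  obtain ⟨h1, h2⟩ := hα
  have hmeas : Measurable fun z : ℝ => ENNReal.ofReal (C * z ^ (-(1 + α))) := by fun_prop
  rw [nuMeasure, integral_withDensity_eq_integral_toReal_smul hmeas
    (Filter.Eventually.of_forall fun _ => ENNReal.ofReal_lt_top),
    ← integral_indicator measurableSet_Ioi]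
  set A : ℝ → ℝ := (Ioc 0 u).indicator fun z => κ * C / u * z ^ (1 - α) with hA
  set B : ℝ → ℝ := (Ioi u).indicator fun z => κ * C * z ^ (-α) with hB
  have hAi : Integrable A := by
    rw [hA, integrable_indicator_iff measurableSet_Ioc]
    refine Integrable.const_mul ?_ _
    rw [← IntegrableOn, integrableOn_Ioc_iff_integrableOn_Ioo,
      intervalIntegral.integrableOn_Ioo_rpow_iff hu]
    linarith
  have hBi : Integrable B := by
    rw [hB, integrable_indicator_iff measurableSet_Ioi]
    exact Integrable.const_mul (integrableOn_Ioi_rpow_of_lt (by linarith) hu) _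
  have hAint : ∫ z, A z = κ * C * (1 / (2 - α)) * u ^ (1 - α) := by
    rw [hA, integral_indicator measurableSet_Ioc, integral_const_mul,
      ← intervalIntegral.integral_of_le hu.le, integral_rpow (Or.inl (by linarith)),
      Real.zero_rpow (by linarith), Real.rpow_add hu, Real.rpow_one]
    have : 1 - α + 1 = 2 - α := by ring
    rw [this]
    have : 2 - α ≠ 0 := by linarith
    field_simp
    ring
  have hBint : ∫ z, B z = κ * C * (1 / (α - 1)) * u ^ (1 - α) := by
    rw [hB, integral_indicator measurableSet_Ioi, integral_const_mul,
      integral_Ioi_rpow_of_lt (by linarith) hu]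
    have h3 : -α + 1 = -(α - 1) := by ring
    have h4 : 1 - α = -(α - 1) := by ring
    rw [h3, h4, neg_div_neg_eq]
    ring
  have hA0 : ∀ z, 0 ≤ A z := fun z => indicator_nonneg (fun z hz => by
    have := Real.rpow_nonneg hz.1.le (1 - α)
    positivity) z
  have hB0 : ∀ z, 0 ≤ B z := fun z => indicator_nonneg (fun z hz => by
    have := Real.rpow_nonneg (hu.trans hz).le (-α)
    positivity) z
  calc _ ≤ ∫ z, (A z + B z) := by
        refine integral_le_of_le_of_nonneg (hAi.add hBi) (fun z => add_nonneg (hA0 z) (hB0 z)) ?_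
        intro z
        rcases le_or_gt z 0 with hz | hz
        · rw [indicator_of_notMem (by simpa using hz)]
          exact add_nonneg (hA0 z) (hB0 z)
        rw [indicator_of_mem (by simpa using hz)]
        have hp : 0 ≤ C * z ^ (-(1 + α)) := by positivity
        simp only [ENNReal.toReal_ofReal hp, smul_eq_mul]
        refine (mul_le_mul_of_nonneg_left (hφ z hz) hp).trans ?_
        rcases le_or_gt z u with hzu | hzu
        · have e : A z + B z = C * z ^ (-(1 + α)) * (κ * (z ^ 2 / u)) := by
            rw [hA, hB, indicator_of_mem (show z ∈ Ioc 0 u from ⟨hz, hzu⟩),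
              indicator_of_notMem (by simpa using hzu),
              show 1 - α = -(1 + α) + (2 : ℕ) by push_cast; ring, Real.rpow_add_natCast hz.ne']
            ring
          rw [e]
          gcongr
          exact min_le_left _ _
        · have e : A z + B z = C * z ^ (-(1 + α)) * (κ * z) := by
            rw [hA, hB, indicator_of_notMem (fun h => hzu.not_ge h.2),
              indicator_of_mem (show z ∈ Ioi u from hzu),
              show -α = -(1 + α) + 1 by ring, Real.rpow_add_one hz.ne']
            ring
          rw [e]
          gcongr
          exact min_le_right _ _
    _ = _ := by
        rw [integral_add hAi hBi, hAint, hBint]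
        ring

/-- First-order Taylor remainder bounded by the oscillation of the derivative. -/
lemma abs_taylor_remainder_le_s14 {f f' : ℝ → ℝ} {a y C : ℝ}
    (hf : ∀ x ∈ uIcc a y, HasDerivAt f (f' x) x) (hC : ∀ x ∈ uIcc a y, |f' x - f' a| ≤ C) :
    |f y - f a - f' a * (y - a)| ≤ C * |y - a| := by
  have h := (convex_uIcc a y).norm_image_sub_le_of_norm_hasDerivWithin_le
    (f := fun x => f x - f' a * x) (f' := fun x => f' x - f' a) (C := C)
    (fun x hx => ((hf x hx).sub
      (by simpa using (hasDerivAt_id x).const_mul (f' a))).hasDerivWithinAt)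
    hC left_mem_uIcc right_mem_uIcc
  rw [Real.norm_eq_abs, Real.norm_eq_abs] at h
  convert h using 2
  ring

/-- Taylor remainder estimate for a function with bounded first and second derivatives. -/
lemma abs_taylor_remainder_le_min {f f' f'' : ℝ → ℝ} {a y u K N : ℝ} (hu : 0 < u)
    (hf : ∀ x ∈ uIcc a y, HasDerivAt f (f' x) x) (hf' : ∀ x ∈ uIcc a y, HasDerivAt f' (f'' x) x)
    (hN : ∀ x ∈ uIcc a y, |f' x| ≤ N) (hK : ∀ x ∈ uIcc a y, |f'' x| ≤ K / u) :
    |f y - f a - f' a * (y - a)| ≤ (K + 2 * N) * min (|y - a| ^ 2 / u) |y - a| := by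
  have hN0 : 0 ≤ N := (abs_nonneg _).trans (hN a left_mem_uIcc)
  have hKu : 0 ≤ K / u := (abs_nonneg _).trans (hK a left_mem_uIcc)
  have hK0 : 0 ≤ K := by simpa [hu.ne'] using mul_nonneg hKu hu.le
  have hw := abs_nonneg (y - a)
  rw [mul_min_of_nonneg _ _ (by positivity)]
  refine le_min ?_ ?_
  · have h : |f y - f a - f' a * (y - a)| ≤ K / u * |y - a| * |y - a| := by
      refine abs_taylor_remainder_le_s14 hf fun x hx => ?_
      have h := (convex_uIcc a y).norm_image_sub_le_of_norm_hasDerivWithin_le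
        (fun x hx => (hf' x hx).hasDerivWithinAt) hK left_mem_uIcc hx
      rw [Real.norm_eq_abs, Real.norm_eq_abs] at h
      exact h.trans (mul_le_mul_of_nonneg_left (abs_sub_left_of_mem_uIcc hx) hKu)
    have h2 : 0 ≤ 2 * N * (|y - a| ^ 2 / u) := by positivity
    calc _ ≤ K / u * |y - a| * |y - a| := h
      _ = K * (|y - a| ^ 2 / u) := by ring
      _ ≤ _ := by linarith
  · have h : |f y - f a - f' a * (y - a)| ≤ 2 * N * |y - a| := by
      refine abs_taylor_remainder_le_s14 hf fun x hx => ?_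
      have h1 := hN x hx
      have h2 := hN a left_mem_uIcc
      rw [abs_le] at *
      constructor <;> linarith
    have h2 : 0 ≤ K * |y - a| := by positivity
    linarith

/-- A global `C^{1,1}` cutoff: `G` vanishes on `(-∞, 1]` and equals `1` on `[2, ∞)`. -/
structure SmoothCutoff (G : ℝ → ℝ) (M : ℝ) : Prop where
  diff : Differentiable ℝ G
  diff_deriv : Differentiable ℝ (deriv G)
  abs_deriv_le : ∀ x, |deriv G x| ≤ M
  abs_deriv_deriv_le : ∀ x, |deriv (deriv G) x| ≤ M
  deriv_nonneg : ∀ x, 0 ≤ deriv G x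
  mem_Icc : ∀ x, G x ∈ Icc (0 : ℝ) 1
  eq_zero : ∀ x, x ≤ 1 → G x = 0
  eq_one : ∀ x, 2 ≤ x → G x = 1

lemma IsCutoff.exists_smoothCutoff {δ : ℝ} {g : ℝ → ℝ} (hg : IsCutoff δ g) :
    ∃ G M, SmoothCutoff G M ∧ ∀ x, 0 ≤ x → G x = g x := by
  obtain ⟨hcd, ⟨M, hM⟩, hmono, hIcc, hzero, -, hone⟩ := hg
  set G : ℝ → ℝ := fun x => g (max x 0) with hG
  have hGg : ∀ x, 0 ≤ x → G x = g x := fun x hx => by simp [hG, hx]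
  have hG0 : ∀ x, x ≤ 1 → G x = 0 := fun x hx =>
    hzero _ (le_max_right _ _) (max_le hx zero_le_one)
  have hM0 : 0 ≤ M := (abs_nonneg _).trans (hM 0 self_mem_Ici).1
  have hcd' : ContDiffOn ℝ 2 g (Ioi 0) := hcd.mono Ioi_subset_Ici_self
  have hpos : ∀ x, 0 < x → G =ᶠ[nhds x] g := fun x hx =>
    Filter.eventuallyEq_of_mem (Ioi_mem_nhds hx) fun y hy => hGg y (le_of_lt hy)
  have hneg : ∀ x, x < 1 → G =ᶠ[nhds x] fun _ => 0 := fun x hx =>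
    Filter.eventuallyEq_of_mem (Iio_mem_nhds hx) fun y hy => hG0 y (le_of_lt hy)
  have hneg' : ∀ x, x < 1 → deriv G =ᶠ[nhds x] fun _ => 0 := fun x hx =>
    (hneg x hx).deriv.trans (by simp)
  have hGmono : Monotone G := fun x y hxy =>
    hmono (mem_Ici.2 (le_max_right _ _)) (mem_Ici.2 (le_max_right _ _)) (max_le_max_right _ hxy)
  refine ⟨G, M, ⟨fun x => ?_, fun x => ?_, fun x => ?_, fun x => ?_, fun x => hGmono.deriv_nonneg,
    fun x => hIcc _ (mem_Ici.2 (le_max_right _ _)), hG0, fun x hx => ?_⟩, hGg⟩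
  · rcases lt_or_ge x 1 with hx | hx
    · exact (hneg x hx).differentiableAt_iff.2 (differentiableAt_const _)
    · have hx : 0 < x := by linarith
      exact (hpos x hx).differentiableAt_iff.2
        ((hcd'.differentiableOn (by norm_num)).differentiableAt (Ioi_mem_nhds hx))
  · rcases lt_or_ge x 1 with hx | hx
    · exact (hneg' x hx).differentiableAt_iff.2 (differentiableAt_const _)
    · have hx : 0 < x := by linarith
      exact (hpos x hx).deriv.differentiableAt_iff.2
        (((hcd'.deriv_of_isOpen (m := 1) isOpen_Ioi (by norm_num)).differentiableOn
          (by norm_num)).differentiableAt (Ioi_mem_nhds hx))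
  · rcases lt_or_ge x 1 with hx | hx
    · simpa [(hneg' x hx).eq_of_nhds] using hM0
    · have hx : 0 < x := by linarith
      rw [(hpos x hx).deriv.eq_of_nhds]
      exact (hM x hx.le).2.1
  · rcases lt_or_ge x 1 with hx | hx
    · simpa [(hneg' x hx).deriv.eq_of_nhds] using hM0
    · have hx : 0 < x := by linarith
      rw [(hpos x hx).deriv.deriv.eq_of_nhds]
      exact (hM x hx.le).2.2
  · rw [hGg x (by linarith), hone x hx]

/-- The profile `r ↦ F(1, r)` built from a cutoff `G`. -/
noncomputable def profile (G : ℝ → ℝ) (x : ℝ) : ℝ := 1 + G x * (x - 1)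

/-- The derivative of `profile`. -/
noncomputable def profileDeriv (G : ℝ → ℝ) (x : ℝ) : ℝ := deriv G x * (x - 1) + G x

/-- The second derivative of `profile`. -/
noncomputable def profileDeriv₂ (G : ℝ → ℝ) (x : ℝ) : ℝ :=
  deriv (deriv G) x * (x - 1) + 2 * deriv G x

lemma Fcut_eq_profile {G g : ℝ → ℝ} (hGg : ∀ x, 0 ≤ x → G x = g x) {s t : ℝ} (hs : 0 < s)
    (ht : 0 ≤ t) : Fcut g s t = s * profile G (t / s) := by
  rw [Fcut, if_neg hs.ne', profile, hGg _ (by positivity)]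
  field_simp
  ring

namespace SmoothCutoff

variable {G : ℝ → ℝ} {M : ℝ}

lemma bound_nonneg (h : SmoothCutoff G M) : 0 ≤ M := (abs_nonneg _).trans (h.abs_deriv_le 0)

lemma deriv_eventuallyEq_zero (h : SmoothCutoff G M) {x : ℝ} (hx : x < 1 ∨ 2 < x) :
    deriv G =ᶠ[nhds x] fun _ => 0 := by
  rcases hx with hx | hx
  · have : G =ᶠ[nhds x] fun _ => 0 :=
      Filter.eventuallyEq_of_mem (Iio_mem_nhds hx) fun y hy => h.eq_zero y (le_of_lt hy)
    exact this.deriv.trans (by simp)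
  · have : G =ᶠ[nhds x] fun _ => 1 :=
      Filter.eventuallyEq_of_mem (Ioi_mem_nhds hx) fun y hy => h.eq_one y (le_of_lt hy)
    exact this.deriv.trans (by simp)

lemma deriv_eq_zero (h : SmoothCutoff G M) {x : ℝ} (hx : x < 1 ∨ 2 < x) : deriv G x = 0 :=
  (h.deriv_eventuallyEq_zero hx).eq_of_nhds

lemma deriv_deriv_eq_zero (h : SmoothCutoff G M) {x : ℝ} (hx : x < 1 ∨ 2 < x) :
    deriv (deriv G) x = 0 := by
  rw [(h.deriv_eventuallyEq_zero hx).deriv.eq_of_nhds, deriv_const]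

lemma hasDerivAt_profile (h : SmoothCutoff G M) (x : ℝ) :
    HasDerivAt (profile G) (profileDeriv G x) x := by
  refine ((((h.diff x).hasDerivAt).mul ((hasDerivAt_id x).sub_const 1)).const_add 1).congr_deriv ?_
  simp [profileDeriv]

lemma hasDerivAt_profileDeriv (h : SmoothCutoff G M) (x : ℝ) :
    HasDerivAt (profileDeriv G) (profileDeriv₂ G x) x := by
  refine HasDerivAt.congr_deriv ((((h.diff_deriv x).hasDerivAt).mul
    ((hasDerivAt_id x).sub_const 1)).add (h.diff x).hasDerivAt) ?_
  simp [profileDeriv₂]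
  ring

lemma profile_of_le (h : SmoothCutoff G M) {x : ℝ} (hx : x ≤ 1) : profile G x = 1 := by
  simp [profile, h.eq_zero x hx]

lemma profile_of_ge (h : SmoothCutoff G M) {x : ℝ} (hx : 2 ≤ x) : profile G x = x := by
  simp [profile, h.eq_one x hx]

lemma profileDeriv_of_lt (h : SmoothCutoff G M) {x : ℝ} (hx : x < 1) : profileDeriv G x = 0 := by
  simp [profileDeriv, h.eq_zero x hx.le, h.deriv_eq_zero (Or.inl hx)]

lemma profileDeriv_of_gt (h : SmoothCutoff G M) {x : ℝ} (hx : 2 < x) : profileDeriv G x = 1 := by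
  simp [profileDeriv, h.eq_one x hx.le, h.deriv_eq_zero (Or.inr hx)]

lemma profileDeriv₂_eq_zero (h : SmoothCutoff G M) {x : ℝ} (hx : x < 1 ∨ 2 < x) :
    profileDeriv₂ G x = 0 := by
  simp [profileDeriv₂, h.deriv_eq_zero hx, h.deriv_deriv_eq_zero hx]

lemma profile_nonneg (h : SmoothCutoff G M) (x : ℝ) : 0 ≤ profile G x := by
  rcases lt_or_ge x 1 with h1 | h1
  · simp [h.profile_of_le h1.le]
  · have := mul_nonneg (h.mem_Icc x).1 (sub_nonneg.2 h1)
    rw [profile]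
    linarith

lemma profile_le_two (h : SmoothCutoff G M) {x : ℝ} (hx : x ≤ 2) : profile G x ≤ 2 := by
  rcases lt_or_ge x 1 with h1 | h1
  · rw [h.profile_of_le h1.le]
    norm_num
  · have := mul_le_mul (h.mem_Icc x).2 (show x - 1 ≤ 1 by linarith) (sub_nonneg.2 h1) zero_le_one
    rw [profile]
    linarith

lemma profileDeriv_nonneg (h : SmoothCutoff G M) (x : ℝ) : 0 ≤ profileDeriv G x := by
  rcases lt_or_ge x 1 with h1 | h1
  · rw [h.profileDeriv_of_lt h1]
  · exact add_nonneg (mul_nonneg (h.deriv_nonneg x) (sub_nonneg.2 h1)) (h.mem_Icc x).1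

lemma profileDeriv_le (h : SmoothCutoff G M) (x : ℝ) : profileDeriv G x ≤ M + 1 := by
  have hM := h.bound_nonneg
  rcases lt_or_ge x 1 with h1 | h1
  · rw [h.profileDeriv_of_lt h1]
    linarith
  rcases lt_or_ge 2 x with h2 | h2
  · rw [h.profileDeriv_of_gt h2]
    linarith
  · have := mul_le_mul ((le_abs_self _).trans (h.abs_deriv_le x)) (show x - 1 ≤ 1 by linarith)
      (sub_nonneg.2 h1) hM
    have := (h.mem_Icc x).2
    rw [profileDeriv]
    linarith

lemma abs_profileDeriv_le (h : SmoothCutoff G M) (x : ℝ) : |profileDeriv G x| ≤ M + 1 := by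
  rw [abs_of_nonneg (h.profileDeriv_nonneg x)]
  exact h.profileDeriv_le x

lemma abs_profileDeriv₂_le (h : SmoothCutoff G M) (x : ℝ) : |profileDeriv₂ G x| ≤ 3 * M := by
  have hM := h.bound_nonneg
  by_cases hx : x < 1 ∨ 2 < x
  · rw [h.profileDeriv₂_eq_zero hx, abs_zero]
    positivity
  · push Not at hx
    calc |profileDeriv₂ G x| ≤ |deriv (deriv G) x| * |x - 1| + 2 * |deriv G x| := by
          refine (abs_add_le _ _).trans ?_
          rw [abs_mul, abs_mul, abs_two]
      _ ≤ M * 1 + 2 * M := by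
          have := h.abs_deriv_deriv_le x
          have := h.abs_deriv_le x
          have : |x - 1| ≤ 1 := abs_le.2 ⟨by linarith, by linarith⟩
          gcongr
      _ = 3 * M := by ring

/-- Bound for the first partial derivative of `F`. -/
lemma abs_profile_sub_le (h : SmoothCutoff G M) (x : ℝ) :
    |profile G x - x * profileDeriv G x| ≤ 2 * M + 4 := by
  have hM := h.bound_nonneg
  rcases lt_or_ge x 1 with h1 | h1
  · rw [h.profileDeriv_of_lt h1, h.profile_of_le h1.le, mul_zero, sub_zero, abs_one]
    linarith
  rcases lt_or_ge 2 x with h2 | h2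
  · rw [h.profileDeriv_of_gt h2, h.profile_of_ge h2.le, mul_one, sub_self, abs_zero]
    linarith
  · have hx : 0 ≤ x := by linarith
    have h3 := mul_le_mul h2 (h.profileDeriv_le x) (h.profileDeriv_nonneg x) zero_le_two
    have h4 := mul_nonneg hx (h.profileDeriv_nonneg x)
    have h5 := h.profile_le_two h2
    have h6 := h.profile_nonneg x
    rw [abs_le]
    constructor <;> linarith

lemma abs_sq_mul_profileDeriv₂_le (h : SmoothCutoff G M) (x : ℝ) :
    |x ^ 2 * profileDeriv₂ G x| ≤ 12 * M := by
  have hM := h.bound_nonneg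
  by_cases hx : x < 1 ∨ 2 < x
  · rw [h.profileDeriv₂_eq_zero hx, mul_zero, abs_zero]
    positivity
  · push Not at hx
    calc |x ^ 2 * profileDeriv₂ G x| = x ^ 2 * |profileDeriv₂ G x| := by
          rw [abs_mul, abs_of_nonneg (sq_nonneg x)]
      _ ≤ 2 ^ 2 * (3 * M) := by
          have := h.abs_profileDeriv₂_le x
          have : 0 ≤ x := by linarith
          gcongr
          exact hx.2
      _ = 12 * M := by ring

lemma hasDerivAt_mul_profile_div (h : SmoothCutoff G M) (t : ℝ) {s : ℝ} (hs : s ≠ 0) :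
    HasDerivAt (fun a => a * profile G (t / a))
      (profile G (t / s) - t / s * profileDeriv G (t / s)) s := by
  have h1 : HasDerivAt (fun a : ℝ => t / a) (-t / s ^ 2) s := by
    refine ((hasDerivAt_const s t).div (hasDerivAt_id s) hs).congr_deriv ?_
    simp
  refine HasDerivAt.congr_deriv ((hasDerivAt_id s).mul
    ((h.hasDerivAt_profile (t / s)).comp s h1)) ?_
  simp
  field_simp
  ring

lemma hasDerivAt_profile_sub (h : SmoothCutoff G M) (t : ℝ) {s : ℝ} (hs : s ≠ 0) :
    HasDerivAt (fun a => profile G (t / a) - t / a * profileDeriv G (t / a))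
      ((t / s) ^ 2 * profileDeriv₂ G (t / s) / s) s := by
  have h1 : HasDerivAt (fun a : ℝ => t / a) (-t / s ^ 2) s := by
    refine ((hasDerivAt_const s t).div (hasDerivAt_id s) hs).congr_deriv ?_
    simp
  refine HasDerivAt.congr_deriv (((h.hasDerivAt_profile (t / s)).comp s h1).sub
    (h1.mul ((h.hasDerivAt_profileDeriv (t / s)).comp s h1))) ?_
  field_simp
  ring

/-- Taylor estimate for `F` in its first argument. -/
lemma taylor_fst_le (h : SmoothCutoff G M) {u z : ℝ} (t : ℝ) (hu : 0 < u) (hz : 0 < z) :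
    (u + z) * profile G (t / (u + z)) - u * profile G (t / u)
        - (profile G (t / u) - t / u * profileDeriv G (t / u)) * z
      ≤ (12 * M + 2 * (2 * M + 4)) * min (z ^ 2 / u) z := by
  have hM := h.bound_nonneg
  have hmem : ∀ x ∈ uIcc u (u + z), u ≤ x := fun x hx => by
    rw [uIcc_of_le (by linarith)] at hx
    exact hx.1
  have key := abs_taylor_remainder_le_min (a := u) (y := u + z) hu
    (fun x hx => h.hasDerivAt_mul_profile_div t (hu.trans_le (hmem x hx)).ne')
    (fun x hx => h.hasDerivAt_profile_sub t (hu.trans_le (hmem x hx)).ne')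
    (fun x _ => h.abs_profile_sub_le (t / x))
    (fun x hx => by
      have hx' := hmem x hx
      rw [abs_div, abs_of_pos (hu.trans_le hx')]
      exact div_le_div₀ (by positivity) (h.abs_sq_mul_profileDeriv₂_le _) hu hx')
  rw [add_sub_cancel_left, abs_of_pos hz] at key
  exact (le_abs_self _).trans key

/-- Taylor estimate for `w ↦ F(u, |w|)`, whose derivative is
`w ↦ profileDeriv G (w / u) - profileDeriv G (-w / u)`. -/
lemma taylor_snd_le (h : SmoothCutoff G M) {u z : ℝ} (w : ℝ) (hu : 0 < u) (hz : 0 < z) :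
    u * profile G (|w + z| / u) - u * profile G (|w| / u)
        - (profileDeriv G (w / u) - profileDeriv G (-w / u)) * z
      ≤ (2 * (3 * M) + 2 * (2 * (M + 1))) * min (z ^ 2 / u) z := by
  have heven : ∀ x, u * profile G (|x| / u)
      = u * (profile G (x / u) + profile G (-x / u) - 1) := fun x => by
    rcases le_total 0 x with hx | hx
    · have : -x / u ≤ 1 := (div_nonpos_of_nonpos_of_nonneg (by linarith) hu.le).trans zero_le_one
      rw [abs_of_nonneg hx, h.profile_of_le this]
      ring
    · have : x / u ≤ 1 := (div_nonpos_of_nonpos_of_nonneg hx hu.le).trans zero_le_one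
      rw [abs_of_nonpos hx, h.profile_of_le this]
      ring
  have hp : ∀ {f : ℝ → ℝ} {f' x : ℝ}, HasDerivAt f f' (x / u) →
      HasDerivAt (fun a => f (a / u)) (f' * (1 / u)) x := fun {_ _ x} hf =>
    hf.comp x ((hasDerivAt_id x).div_const u)
  have hn : ∀ {f : ℝ → ℝ} {f' x : ℝ}, HasDerivAt f f' (-x / u) →
      HasDerivAt (fun a => f (-a / u)) (f' * (-1 / u)) x := fun {_ _ x} hf =>
    hf.comp x ((hasDerivAt_id x).neg.div_const u)
  have key := abs_taylor_remainder_le_min (a := w) (y := w + z)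
    (f := fun x => u * (profile G (x / u) + profile G (-x / u) - 1))
    (f' := fun x => profileDeriv G (x / u) - profileDeriv G (-x / u))
    (f'' := fun x => (profileDeriv₂ G (x / u) + profileDeriv₂ G (-x / u)) / u)
    (K := 2 * (3 * M)) (N := 2 * (M + 1)) hu
    (fun x _ => by
      refine HasDerivAt.congr_deriv ((((hp (h.hasDerivAt_profile (x / u))).add
        (hn (h.hasDerivAt_profile (-x / u)))).sub_const 1).const_mul u) ?_
      field_simp
      ring)
    (fun x _ => by
      refine HasDerivAt.congr_deriv ((hp (h.hasDerivAt_profileDeriv (x / u))).sub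
        (hn (h.hasDerivAt_profileDeriv (-x / u)))) ?_
      field_simp
      ring)
    (fun x _ => by
      have h1 := abs_le.1 (h.abs_profileDeriv_le (x / u))
      have h2 := abs_le.1 (h.abs_profileDeriv_le (-x / u))
      exact abs_le.2 ⟨by linarith, by linarith⟩)
    (fun x _ => by
      have h1 := abs_le.1 (h.abs_profileDeriv₂_le (x / u))
      have h2 := abs_le.1 (h.abs_profileDeriv₂_le (-x / u))
      rw [abs_div, abs_of_pos hu]
      gcongr
      exact abs_le.2 ⟨by linarith, by linarith⟩)
  rw [add_sub_cancel_left, abs_of_pos hz] at key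
  rw [heven, heven]
  exact (le_abs_self _).trans key

end SmoothCutoff

lemma D1_Vct_s14 {G g : ℝ → ℝ} {M : ℝ} (h : SmoothCutoff G M) (hGg : ∀ x, 0 ≤ x → G x = g x)
    (c θ : ℝ) {u v : ℝ} (hu : 0 < u) (hv : 0 ≤ v) :
    D1 (Vct g c θ) u v = c * (1 + θ * u ^ (θ - 1))
      + (profile G (v / u) - v / u * profileDeriv G (v / u)) := by
  have he : (fun a => Vct g c θ a v) =ᶠ[nhds u]
      fun a => c * (a + a ^ θ) + a * profile G (v / a) :=
    Filter.eventuallyEq_of_mem (Ioi_mem_nhds hu) fun a ha => by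
      simp only [Vct, Fcut_eq_profile hGg (show 0 < a from ha) hv]
  rw [D1, he.deriv_eq]
  exact ((((hasDerivAt_id u).add (Real.hasDerivAt_rpow_const (Or.inl hu.ne'))).const_mul c).add
    (h.hasDerivAt_mul_profile_div v hu.ne')).deriv

lemma D2_Vct_s14 {G g : ℝ → ℝ} {M : ℝ} (h : SmoothCutoff G M) (hGg : ∀ x, 0 ≤ x → G x = g x)
    (c θ : ℝ) {u v : ℝ} (hu : 0 < u) (hv : 0 ≤ v) :
    D2 (Vct g c θ) u v = profileDeriv G (v / u) := by
  have hd : HasDerivAt (fun a => c * (u + u ^ θ) + u * profile G (a / u))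
      (profileDeriv G (v / u)) v := by
    refine HasDerivAt.congr_deriv ((((h.hasDerivAt_profile (v / u)).comp v
      ((hasDerivAt_id v).div_const u)).const_mul u).const_add (c * (u + u ^ θ))) ?_
    field_simp
  have heq : ∀ a ∈ Ici (0 : ℝ), Vct g c θ u a = c * (u + u ^ θ) + u * profile G (a / u) :=
    fun a ha => by rw [Vct, Fcut_eq_profile hGg hu ha]
  rcases hv.eq_or_lt with rfl | hv
  · by_cases hdiff : DifferentiableAt ℝ (fun a => Vct g c θ u a) 0
    · exact (uniqueDiffWithinAt_Ici 0).eq_deriv _ hdiff.hasDerivAt.hasDerivWithinAt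
        (hd.hasDerivWithinAt.congr heq (heq 0 self_mem_Ici))
    · rw [D2, deriv_zero_of_not_differentiableAt hdiff, zero_div,
        h.profileDeriv_of_lt zero_lt_one]
  · have he : (fun a => Vct g c θ u a) =ᶠ[nhds v]
        fun a => c * (u + u ^ θ) + u * profile G (a / u) :=
      Filter.eventuallyEq_of_mem (Ici_mem_nhds hv) heq
    rw [D2, he.deriv_eq, hd.deriv]

lemma profileDeriv_mul_sgn' {G : ℝ → ℝ} {M u : ℝ} (h : SmoothCutoff G M) (hu : 0 < u)
    (x xt : ℝ) :
    profileDeriv G (|x - xt| / u) * sgn' x xt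
      = profileDeriv G ((x - xt) / u) - profileDeriv G (-(x - xt) / u) := by
  rcases lt_trichotomy (x - xt) 0 with hx | hx | hx
  · have h0 : (x - xt) / u < 1 := (div_neg_of_neg_of_pos hx hu).trans zero_lt_one
    rw [sgn', if_neg (by rintro rfl; simp at hx), abs_of_neg hx, h.profileDeriv_of_lt h0,
      div_neg, div_self hx.ne]
    ring
  · simp [hx, h.profileDeriv_of_lt zero_lt_one]
  · have h0 : -(x - xt) / u < 1 :=
      (div_neg_of_neg_of_pos (by linarith) hu).trans zero_lt_one
    rw [sgn', if_neg (by rintro rfl; simp at hx), abs_of_pos hx, h.profileDeriv_of_lt h0,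
      div_self hx.ne']
    ring

/-- The tangent line of a concave power lies above its graph. -/
lemma add_rpow_le_tangent {u z θ : ℝ} (hu : 0 < u) (hz : 0 ≤ z) (h0 : 0 ≤ θ) (h1 : θ ≤ 1) :
    (u + z) ^ θ ≤ u ^ θ + θ * u ^ (θ - 1) * z := by
  have hzu : 0 ≤ z / u := by positivity
  have h := rpow_one_add_le_one_add_mul_self (s := z / u) (by linarith) h0 h1
  have e : u + z = u * (1 + z / u) := by field_simp
  rw [e, Real.mul_rpow hu.le (by linarith), Real.rpow_sub_one hu.ne']
  calc u ^ θ * (1 + z / u) ^ θ ≤ u ^ θ * (1 + θ * (z / u)) := by gcongr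
    _ = _ := by ring

lemma rpow_le_self_add_rpow {u p θ : ℝ} (hu : 0 < u) (h1 : θ ≤ p) (h2 : p ≤ 1) :
    u ^ p ≤ u + u ^ θ := by
  rcases le_total u 1 with h | h
  · exact (Real.rpow_le_rpow_of_exponent_ge hu h h1).trans (le_add_of_nonneg_left hu.le)
  · have := Real.rpow_le_rpow_of_exponent_le h h2
    rw [Real.rpow_one] at this
    exact this.trans (le_add_of_nonneg_right (Real.rpow_nonneg hu.le θ))

lemma mul_integral_nuMeasure_le {C α κ u θ : ℝ} (hC : 0 < C) (hα : α ∈ Ioo (1 : ℝ) 2)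
    (hκ : 0 ≤ κ) (hθ : θ ≤ 2 - α) (hu : 0 < u) {φ : ℝ → ℝ}
    (hφ : ∀ z, 0 < z → φ z ≤ κ * min (z ^ 2 / u) z) :
    u * ∫ z, φ z ∂(nuMeasure C α)
      ≤ κ * C * (1 / (2 - α) + 1 / (α - 1)) * (u + u ^ θ) := by
  have h2 : 0 < 2 - α := sub_pos.2 hα.2
  have h1 : 0 < α - 1 := sub_pos.2 hα.1
  calc u * ∫ z, φ z ∂(nuMeasure C α)
      ≤ u * (κ * C * (1 / (2 - α) + 1 / (α - 1)) * u ^ (1 - α)) := by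
        gcongr
        exact integral_nuMeasure_le hC hα hκ hu hφ
    _ = κ * C * (1 / (2 - α) + 1 / (α - 1)) * u ^ (2 - α) := by
        rw [show 2 - α = 1 - α + 1 by ring, Real.rpow_add_one hu.ne']
        ring
    _ ≤ _ := by
        gcongr
        exact rpow_le_self_add_rpow hu hθ (by linarith)

/-- The drift in the second argument contracts `F` up to a multiple of the first argument. -/
lemma SmoothCutoff.profile_le_mul_profileDeriv_add {G : ℝ → ℝ} {M r : ℝ} (h : SmoothCutoff G M)
    (hr : 0 ≤ r) : profile G r ≤ r * profileDeriv G r + 2 := by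
  rcases le_or_gt r 2 with h2 | h2
  · have := mul_nonneg hr (h.profileDeriv_nonneg r)
    have := h.profile_le_two h2
    linarith
  · rw [h.profileDeriv_of_gt h2, h.profile_of_ge h2.le]
    linarith

/-- A Foster–Lyapunov bound with the growth in `u` collected in one constant `A` independent
of `c`. -/
lemma exists_LstarSync_Vct_le {b lam α β Cα Cβ θ M : ℝ} {G g : ℝ → ℝ} (hb : 0 < b)
    (hlam : 0 < lam) (hα : α ∈ Ioo (1 : ℝ) 2) (hβ : β ∈ Ioo (1 : ℝ) 2) (hCα : 0 < Cα)
    (hCβ : 0 < Cβ) (h : SmoothCutoff G M) (hGg : ∀ x, 0 ≤ x → G x = g x) (hθ : 0 < θ)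
    (hθα : θ ≤ 2 - α) (hθβ : θ ≤ 2 - β) :
    ∃ A, 0 ≤ A ∧ ∀ c, 0 ≤ c → ∀ y yt x xt : ℝ, yt < y →
      LstarSync b lam Cβ β Cα α (Vct g c θ) y yt x xt
        ≤ (A - b * c * θ) * ((y - yt) + (y - yt) ^ θ) - lam * Fcut g (y - yt) |x - xt| := by
  have hM := h.bound_nonneg
  have hθ1 : θ ≤ 1 := by linarith [hα.1]
  set κβ := 12 * M + 2 * (2 * M + 4) with hκβ
  set κα := 2 * (3 * M) + 2 * (2 * (M + 1)) with hκα
  have hκβ0 : 0 ≤ κβ := by positivity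
  have hκα0 : 0 ≤ κα := by positivity
  set Kβ := κβ * Cβ * (1 / (2 - β) + 1 / (β - 1)) with hKβ
  set Kα := κα * Cα * (1 / (2 - α) + 1 / (α - 1)) with hKα
  have hKβ0 : 0 ≤ Kβ := by
    have := sub_pos.2 hβ.1
    have := sub_pos.2 hβ.2
    positivity
  have hKα0 : 0 ≤ Kα := by
    have := sub_pos.2 hα.1
    have := sub_pos.2 hα.2
    positivity
  refine ⟨b * (2 * M + 4) + 2 * lam + Kβ + Kα, by positivity, fun c hc y yt x xt hy => ?_⟩
  set u := y - yt with hu'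
  have hu : 0 < u := sub_pos.2 hy
  set v := |x - xt| with hv'
  have hv : 0 ≤ v := abs_nonneg _
  rw [LstarSync, ← hu', ← hv', D1_Vct_s14 h hGg c θ hu hv, D2_Vct_s14 h hGg c θ hu hv,
    Fcut_eq_profile hGg hu hv]
  have hIβ := mul_integral_nuMeasure_le (θ := θ) hCβ hβ hκβ0 hθβ hu
    (φ := fun z => Vct g c θ (u + z) v - Vct g c θ u v - (c * (1 + θ * u ^ (θ - 1))
      + (profile G (v / u) - v / u * profileDeriv G (v / u))) * z) fun z hz => by
      have h1 := h.taylor_fst_le v hu hz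
      have h2 := mul_le_mul_of_nonneg_left (add_rpow_le_tangent hu hz.le hθ.le hθ1) hc
      rw [Vct, Vct, Fcut_eq_profile hGg hu hv, Fcut_eq_profile hGg (by positivity) hv]
      linarith
  have hIα := mul_integral_nuMeasure_le (θ := θ) hCα hα hκα0 hθα hu
    (φ := fun z => Vct g c θ u |x - xt + z| - Vct g c θ u v
      - profileDeriv G (v / u) * sgn' x xt * z) fun z hz => by
      have h1 := h.taylor_snd_le (x - xt) hu hz
      rw [profileDeriv_mul_sgn' h hu, Vct, Vct, Fcut_eq_profile hGg hu hv,
        Fcut_eq_profile hGg hu (abs_nonneg _)]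
      linarith
  have hup : 0 ≤ u ^ θ := Real.rpow_nonneg hu.le θ
  have hur : u * u ^ (θ - 1) = u ^ θ := by
    rw [Real.rpow_sub_one hu.ne']
    field_simp
  have hfst : -b * u * (c * (1 + θ * u ^ (θ - 1))
      + (profile G (v / u) - v / u * profileDeriv G (v / u)))
      ≤ -(b * c * θ) * (u + u ^ θ) + b * (2 * M + 4) * u := by
    have h1 := (abs_le.1 (h.abs_profile_sub_le (v / u))).1
    have h2 := mul_le_mul_of_nonneg_left h1 (mul_nonneg hb.le hu.le)
    have h3 := mul_le_mul_of_nonneg_left hθ1 (mul_nonneg (mul_nonneg hb.le hc) hu.le)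
    rw [← hur]
    linarith
  have hsnd : -(lam * v * profileDeriv G (v / u))
      ≤ 2 * lam * u - lam * (u * profile G (v / u)) := by
    have h1 := mul_le_mul_of_nonneg_left
      (h.profile_le_mul_profileDeriv_add (r := v / u) (by positivity)) (mul_nonneg hlam.le hu.le)
    have e : lam * u * (v / u * profileDeriv G (v / u) + 2)
        = lam * v * profileDeriv G (v / u) + 2 * lam * u := by
      field_simp
    linarith
  have hrest : 0 ≤ (b * (2 * M + 4) + 2 * lam) * u ^ θ := by positivity
  linarith

/-- Proposition 4.1: for every `θ ∈ (0, 2 - (α ∨ β)]` there exist constants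
`c, η > 0` such that for all `y > ỹ ≥ 0` and `x, x̃ ∈ ℝ`,
`(L* V_{c,θ})(y,ỹ,x,x̃) ≤ -η V_{c,θ}(y - ỹ, |x - x̃|)`. -/
theorem stmt14 (b lam α β Cα Cβ δ : ℝ) (hb : 0 < b) (hlam : 0 < lam)
    (hα : α ∈ Ioo (1 : ℝ) 2) (hβ : β ∈ Ioo (1 : ℝ) 2)
    (hCα : 0 < Cα) (hCβ : 0 < Cβ) (hδ : 0 < δ)
    (g : ℝ → ℝ) (hg : IsCutoff δ g) :
    ∀ θ ∈ Ioc (0 : ℝ) (2 - max α β), ∃ c η : ℝ, 0 < c ∧ 0 < η ∧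
      ∀ y yt x xt : ℝ, 0 ≤ yt → yt < y →
        LstarSync b lam Cβ β Cα α (Vct g c θ) y yt x xt
          ≤ -η * Vct g c θ (y - yt) |x - xt| := by
  intro θ ⟨hθ0, hθ⟩
  have hθα : θ ≤ 2 - α := hθ.trans (sub_le_sub_left (le_max_left _ _) _)
  have hθβ : θ ≤ 2 - β := hθ.trans (sub_le_sub_left (le_max_right _ _) _)
  obtain ⟨G, M, h, hGg⟩ := hg.exists_smoothCutoff
  obtain ⟨A, hA, hL⟩ := exists_LstarSync_Vct_le hb hlam hα hβ hCα hCβ h hGg hθ0 hθα hθβ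
  have hbθ : 0 < b * θ := mul_pos hb hθ0
  have hc : 0 < (A + 1) / (b * θ) := by positivity
  set c := (A + 1) / (b * θ) with hc'
  have hbc : b * c * θ = A + 1 := by
    rw [hc']
    field_simp
  refine ⟨c, min (1 / c) lam, hc, by positivity, fun y yt x xt _ hy => ?_⟩
  refine (hL c hc.le y yt x xt hy).trans ?_
  have hu : 0 < y - yt := sub_pos.2 hy
  have hF : 0 ≤ Fcut g (y - yt) |x - xt| := by
    rw [Fcut_eq_profile hGg hu (abs_nonneg _)]
    exact mul_nonneg hu.le (h.profile_nonneg _)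
  have hU : 0 ≤ (y - yt) + (y - yt) ^ θ := by positivity
  have h1 : min (1 / c) lam * c ≤ 1 := by
    calc min (1 / c) lam * c ≤ 1 / c * c := by
          gcongr
          exact min_le_left _ _
      _ = 1 := by field_simp
  have h2 := mul_le_mul_of_nonneg_right h1 hU
  have h3 := mul_le_mul_of_nonneg_right (min_le_right (1 / c) lam) hF
  rw [hbc, Vct]
  linarith
end

section
/- Let β ∈ (1,2) and C_β > 0, and let g and F be as defined. Then there exists a constant C > 0 such that for all u > 0 and all v ≥ 0: ∫_0^∞ ( F(u + z, v) − F(u, v) − ∂_1F(u, v)·z ) ν_β(dz) ≤ C·u^{1−β}. -/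
open Set MeasureTheory

lemma IsCutoff.hasDerivAt {δ : ℝ} {g : ℝ → ℝ} (hg : IsCutoff δ g) {r : ℝ} (hr : 0 < r) :
    HasDerivAt g (deriv g r) r :=
  ((hg.1.contDiffAt (Ici_mem_nhds hr)).differentiableAt (by norm_num)).hasDerivAt

lemma IsCutoff.hasDerivAt_deriv {δ : ℝ} {g : ℝ → ℝ} (hg : IsCutoff δ g) {r : ℝ} (hr : 0 < r) :
    HasDerivAt (deriv g) (deriv (deriv g) r) r :=
  (((hg.1.contDiffAt (Ici_mem_nhds hr)).derivWithin (m := 1) (by norm_num)).differentiableAt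
    (by norm_num)).hasDerivAt

lemma IsCutoff.deriv_eq_zero {δ : ℝ} {g : ℝ → ℝ} (hg : IsCutoff δ g) {r : ℝ} (hr : 2 < r) :
    deriv g r = 0 := by
  have h : g =ᶠ[nhds r] fun _ => 1 := by
    filter_upwards [Ioi_mem_nhds hr] with x hx using hg.2.2.2.2.2.2 x (le_of_lt hx)
  rw [h.deriv_eq, deriv_const]

lemma IsCutoff.deriv_deriv_eq_zero {δ : ℝ} {g : ℝ → ℝ} (hg : IsCutoff δ g) {r : ℝ}
    (hr : 2 < r) : deriv (deriv g) r = 0 := by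
  have h : deriv g =ᶠ[nhds r] fun _ => 0 := by
    filter_upwards [Ioi_mem_nhds hr] with x hx using hg.deriv_eq_zero hx
  rw [h.deriv_eq, deriv_const]

lemma IsCutoff.hasDerivAt_Fcut {δ : ℝ} {g : ℝ → ℝ} (hg : IsCutoff δ g) {s v : ℝ} (hs : 0 < s)
    (hv : 0 < v) :
    HasDerivAt (fun a => Fcut g a v)
      (1 - g (v / s) - v / s * (v / s - 1) * deriv g (v / s)) s := by
  have h1 : HasDerivAt (fun a : ℝ => v / a) (-v / s ^ 2) s := by
    simpa [div_eq_mul_inv] using (hasDerivAt_inv hs.ne').const_mul v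
  have h2 : HasDerivAt (fun a => g (v / a)) (deriv g (v / s) * (-v / s ^ 2)) s :=
    (hg.hasDerivAt (div_pos hv hs)).comp s h1
  have h3 := ((h2.const_sub 1).mul (hasDerivAt_id s)).add (h2.mul_const v)
  have h4 : (fun a => Fcut g a v) =ᶠ[nhds s]
      (((fun a => 1 - g (v / a)) * id) + fun a => g (v / a) * v) := by
    filter_upwards [Ioi_mem_nhds hs] with a ha
    simp [Fcut, (show a ≠ 0 from (ne_of_gt ha))]
  refine (h3.congr_of_eventuallyEq h4).congr_deriv ?_
  simp only [id]
  field_simp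
  ring

lemma IsCutoff.abs_deriv_Fcut_le {δ M : ℝ} {g : ℝ → ℝ} (hg : IsCutoff δ g)
    (hM : ∀ r ∈ Ici (0 : ℝ), |deriv g r| ≤ M) {r : ℝ} (hr : 0 < r) :
    |1 - g r - r * (r - 1) * deriv g r| ≤ 1 + 2 * M := by
  have hM0 : 0 ≤ M := (abs_nonneg _).trans (hM r hr.le)
  obtain h | h := le_or_gt r 2
  · obtain ⟨h0, h1⟩ := hg.2.2.2.1 r hr.le
    refine (abs_sub _ _).trans (add_le_add (abs_le.2 ⟨by linarith, by linarith⟩) ?_)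
    rw [abs_mul]
    exact mul_le_mul (abs_le.2 ⟨by nlinarith, by nlinarith⟩) (hM r hr.le) (abs_nonneg _)
      (by norm_num)
  · rw [hg.deriv_eq_zero h, hg.2.2.2.2.2.2 r h.le]
    simp; linarith

lemma IsCutoff.hasDerivAt_deriv_Fcut {δ : ℝ} {g : ℝ → ℝ} (hg : IsCutoff δ g) {s v : ℝ}
    (hs : 0 < s) (hv : 0 < v) :
    HasDerivAt (fun a => 1 - g (v / a) - v / a * (v / a - 1) * deriv g (v / a))
      (v / s * (v / s) * (2 * deriv g (v / s) + (v / s - 1) * deriv (deriv g) (v / s)) / s) s := by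
  have h1 : HasDerivAt (fun a : ℝ => v / a) (-v / s ^ 2) s := by
    simpa [div_eq_mul_inv] using (hasDerivAt_inv hs.ne').const_mul v
  have h2 : HasDerivAt (fun a => g (v / a)) (deriv g (v / s) * (-v / s ^ 2)) s :=
    (hg.hasDerivAt (div_pos hv hs)).comp s h1
  have h3 : HasDerivAt (fun a => deriv g (v / a)) (deriv (deriv g) (v / s) * (-v / s ^ 2)) s :=
    (hg.hasDerivAt_deriv (div_pos hv hs)).comp s h1
  refine ((h2.const_sub 1).sub ((h1.mul (h1.sub_const 1)).mul h3)).congr_deriv ?_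
  simp only [Pi.mul_apply]
  field_simp
  ring

lemma IsCutoff.abs_deriv_deriv_Fcut_le {δ M : ℝ} {g : ℝ → ℝ} (hg : IsCutoff δ g)
    (hM : ∀ r ∈ Ici (0 : ℝ), |deriv g r| ≤ M) (hM' : ∀ r ∈ Ici (0 : ℝ), |deriv (deriv g) r| ≤ M)
    {r : ℝ} (hr : 0 < r) :
    |r * r * (2 * deriv g r + (r - 1) * deriv (deriv g) r)| ≤ 12 * M := by
  have hM0 : 0 ≤ M := (abs_nonneg _).trans (hM r hr.le)
  obtain h | h := le_or_gt r 2
  · have h1 : |2 * deriv g r + (r - 1) * deriv (deriv g) r| ≤ 3 * M := by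
      refine (abs_add_le _ _).trans ?_
      rw [abs_mul, abs_mul, abs_two]
      have := mul_le_mul (abs_le.2 ⟨by linarith, by linarith⟩ : |r - 1| ≤ 1) (hM' r hr.le)
        (abs_nonneg _) (by norm_num)
      linarith [hM r hr.le]
    have h2 : |r * r| ≤ 4 := abs_le.2 ⟨by nlinarith, by nlinarith⟩
    rw [abs_mul]
    linarith [mul_le_mul h2 h1 (abs_nonneg _) (by norm_num)]
  · rw [hg.deriv_eq_zero h, hg.deriv_deriv_eq_zero h]
    simpa using hM0

/-- A first order Taylor remainder is at most linear if the derivative is bounded, and at most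
quadratic if the second derivative is bounded. -/
lemma abs_taylor_remainder_le_s15 {f f' f'' : ℝ → ℝ} {u z L K : ℝ} (hz : 0 < z)
    (hf : ∀ s, u ≤ s → HasDerivAt f (f' s) s) (hf' : ∀ s, u ≤ s → HasDerivAt f' (f'' s) s)
    (hL : ∀ s, u ≤ s → |f' s| ≤ L) (hK : ∀ s, u ≤ s → |f'' s| ≤ K) :
    |f (u + z) - f u - f' u * z| ≤ 2 * L * z ∧ |f (u + z) - f u - f' u * z| ≤ K * z ^ 2 := by
  obtain ⟨c, hc, hfc⟩ := exists_hasDerivAt_eq_slope f f' (by linarith : u < u + z)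
    (fun s hs => (hf s hs.1).continuousAt.continuousWithinAt) (fun s hs => hf s hs.1.le)
  have e : f (u + z) - f u - f' u * z = (f' c - f' u) * z := by
    rw [sub_mul, hfc, add_sub_cancel_left, div_mul_cancel₀ _ hz.ne']
  have hK0 : 0 ≤ K := (abs_nonneg _).trans (hK u le_rfl)
  rw [e, abs_mul, abs_of_pos hz]
  constructor
  · gcongr
    exact (abs_sub _ _).trans (by linarith [hL c hc.1.le, hL u le_rfl])
  · have h := (convex_Ici u).norm_image_sub_le_of_norm_hasDerivWithin_le (C := K)
      (fun s hs => (hf' s hs).hasDerivWithinAt) (fun s hs => hK s hs) (self_mem_Ici) hc.1.le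
    rw [Real.norm_eq_abs, Real.norm_eq_abs, abs_of_pos (by linarith [hc.1] : 0 < c - u)] at h
    rw [pow_two, ← mul_assoc]
    gcongr
    refine h.trans ?_
    gcongr
    linarith [hc.2]

/-- A function bounded by `K / u * z ^ 2` for small jumps and by `L * z` for large ones has
integral of order `u ^ (1 - β)` against the `β`-stable Lévy measure. -/
lemma integral_nuMeasure_le_s15 {β Cβ K L u : ℝ} (hβ : β ∈ Ioo (1 : ℝ) 2) (hCβ : 0 < Cβ)
    (hu : 0 < u) {f : ℝ → ℝ} (hL : ∀ z, 0 < z → |f z| ≤ L * z)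
    (hK : ∀ z, 0 < z → |f z| ≤ K / u * z ^ 2) :
    ∫ z, f z ∂(nuMeasure Cβ β) ≤ Cβ * (K / (2 - β) + L / (β - 1)) * u ^ (1 - β) := by
  obtain ⟨h1, h2⟩ := hβ
  rw [nuMeasure, integral_withDensity_eq_integral_toReal_smul
    (by fun_prop) (by simp)]
  have hi1 : IntegrableOn (fun z : ℝ => z ^ (1 - β)) (Ioc 0 u) :=
    (intervalIntegrable_iff_integrableOn_Ioc_of_le hu.le).1
      (intervalIntegral.intervalIntegrable_rpow' (by linarith))
  have hi2 : IntegrableOn (fun z : ℝ => z ^ (-β)) (Ioi u) :=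
    integrableOn_Ioi_rpow_of_lt (by linarith) hu
  have hI1 : ∫ z in Ioc 0 u, z ^ (1 - β) = u ^ (2 - β) / (2 - β) := by
    rw [← intervalIntegral.integral_of_le hu.le, integral_rpow (Or.inl (by linarith)),
      show 1 - β + 1 = 2 - β by ring, Real.zero_rpow (by linarith), sub_zero]
  have hI2 : ∫ z in Ioi u, z ^ (-β) = u ^ (1 - β) / (β - 1) := by
    rw [integral_Ioi_rpow_of_lt (by linarith) hu, show -β + 1 = 1 - β by ring, neg_div,
      ← div_neg, neg_sub]
  have hj1 := (integrable_indicator_iff measurableSet_Ioc).2 (hi1.const_mul (Cβ * (K / u)))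
  have hj2 := (integrable_indicator_iff measurableSet_Ioi).2 (hi2.const_mul (Cβ * L))
  refine (Real.le_norm_self _).trans ((norm_integral_le_of_norm_le
    (hj1.add hj2).integrableOn ?_).trans (le_of_eq ?_))
  · refine (ae_restrict_iff' measurableSet_Ioi).2 (Filter.Eventually.of_forall fun z hz => ?_)
    have hz : 0 < z := hz
    have hd : 0 ≤ Cβ * z ^ (-(1 + β)) := by positivity
    rw [ENNReal.toReal_ofReal hd, smul_eq_mul, norm_mul, Real.norm_of_nonneg hd,
      Real.norm_eq_abs, Pi.add_apply]
    obtain h | h := le_or_gt z u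
    · rw [indicator_of_mem (show z ∈ Ioc 0 u from ⟨hz, h⟩),
        indicator_of_notMem (show z ∉ Ioi u from not_lt.2 h), add_zero,
        show 1 - β = -(1 + β) + (2 : ℕ) by push_cast; ring, Real.rpow_add_natCast hz.ne']
      calc _ ≤ Cβ * z ^ (-(1 + β)) * (K / u * z ^ 2) := by gcongr; exact hK z hz
        _ = _ := by ring
    · rw [indicator_of_notMem (fun h' : z ∈ Ioc 0 u => absurd h'.2 (not_le.2 h)),
        indicator_of_mem (show z ∈ Ioi u from h), zero_add,
        show -β = -(1 + β) + 1 by ring, Real.rpow_add_one hz.ne']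
      calc _ ≤ Cβ * z ^ (-(1 + β)) * (L * z) := by gcongr; exact hL z hz
        _ = _ := by ring
  · rw [integral_add' hj1.integrableOn hj2.integrableOn,
      setIntegral_indicator measurableSet_Ioc, setIntegral_indicator measurableSet_Ioi,
      inter_eq_right.2 Ioc_subset_Ioi_self, inter_eq_right.2 (Ioi_subset_Ioi hu.le),
      integral_const_mul, integral_const_mul, hI1, hI2,
      show 2 - β = 1 - β + 1 by ring, Real.rpow_add_one hu.ne']
    field_simp

/-- Estimate \eqref{K4} on `Υ₃`: there is `C > 0` such that for all `u > 0`
and `v ≥ 0`,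
`∫₀^∞ (F(u+z,v) - F(u,v) - ∂₁F(u,v) z) ν_β(dz) ≤ C u^{1-β}`. -/
theorem stmt15 (β Cβ δ : ℝ) (hβ : β ∈ Ioo (1 : ℝ) 2) (hCβ : 0 < Cβ) (hδ : 0 < δ)
    (g : ℝ → ℝ) (hg : IsCutoff δ g) :
    ∃ C : ℝ, 0 < C ∧ ∀ u v : ℝ, 0 < u → 0 ≤ v →
      (∫ z, (Fcut g (u + z) v - Fcut g u v - D1 (Fcut g) u v * z) ∂(nuMeasure Cβ β))
        ≤ C * u ^ (1 - β) := by
  obtain ⟨M, hM⟩ := hg.2.1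
  have hM1 := fun r hr => (hM r hr).2.1
  have hM2 := fun r hr => (hM r hr).2.2
  have hM0 : 0 ≤ M := (abs_nonneg _).trans (hM 0 self_mem_Ici).1
  have hb1 : 0 < β - 1 := by linarith [hβ.1]
  have hb2 : 0 < 2 - β := by linarith [hβ.2]
  refine ⟨Cβ * (12 * M / (2 - β) + 2 * (1 + 2 * M) / (β - 1)), by positivity,
    fun u v hu hv => ?_⟩
  have key : ∀ z, 0 < z → |Fcut g (u + z) v - Fcut g u v - D1 (Fcut g) u v * z|
        ≤ 2 * (1 + 2 * M) * z ∧
      |Fcut g (u + z) v - Fcut g u v - D1 (Fcut g) u v * z| ≤ 12 * M / u * z ^ 2 := by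
    intro z hz
    obtain rfl | hv := hv.eq_or_lt
    · have h0 : ∀ s, Fcut g s 0 = s := fun s => by
        by_cases hs : s = 0 <;> simp [Fcut, hs, hg.2.2.2.2.1 0 le_rfl zero_le_one]
      simp only [D1, h0, deriv_id'']
      rw [show u + z - u - 1 * z = 0 by ring, abs_zero]
      exact ⟨by positivity, by positivity⟩
    · have h0 : ∀ s, u ≤ s → 0 < s := fun s hs => hu.trans_le hs
      rw [show D1 (Fcut g) u v = _ from (hg.hasDerivAt_Fcut hu hv).deriv]
      refine abs_taylor_remainder_le_s15 (f := fun a => Fcut g a v)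
        (f' := fun a => 1 - g (v / a) - v / a * (v / a - 1) * deriv g (v / a)) hz
        (fun s hs => hg.hasDerivAt_Fcut (h0 s hs) hv)
        (fun s hs => hg.hasDerivAt_deriv_Fcut (h0 s hs) hv)
        (fun s hs => hg.abs_deriv_Fcut_le hM1 (div_pos hv (h0 s hs)))
        (fun s hs => ?_)
      rw [abs_div, abs_of_pos (h0 s hs)]
      exact div_le_div₀ (by positivity)
        (hg.abs_deriv_deriv_Fcut_le hM1 hM2 (div_pos hv (h0 s hs))) hu hs
  exact integral_nuMeasure_le_s15 hβ hCβ hu (fun z hz => (key z hz).1) fun z hz => (key z hz).2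
end
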